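/- Let a C¹-spacetime on ℝⁿ be globally hyperbolic, let p, q ∈ ℝⁿ with p ≪ q, and let x : I → ℝⁿ be a future-directed causal geodesic defined on an interval I with min I = 0 and x(0) = q. Then the function t ↦ T(p, x(t)) is strictly increasing on I. -/

import Mathlib

open Set Filter Topology MeasureTheory
open scoped ENNReal NNReal

noncomputable section

/-- Points of ℝⁿ. -/
abbrev SpacetimePt (n : ℕ) := Fin n → ℝ

/-- Evaluation of a bilinear form given by a coefficient matrix. -/
def bilForm {n : ℕ} (g : Fin n → Fin n → ℝ) (u v : Fin n → ℝ) : ℝ :=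
  ∑ i, ∑ j, g i j * u i * v j

/-- The Minkowski matrix diag(−1,1,…,1). -/
def minkowskiMatrix (n : ℕ) : Fin n → Fin n → ℝ := fun i j =>
  if i = j then (if (i : ℕ) = 0 then -1 else 1) else 0

/-- A time-oriented C¹-spacetime on ℝⁿ: a C¹ family of symmetric bilinear forms of
Lorentzian signature (−,+,…,+), together with a continuous timelike vector field. -/
structure C1Spacetime (n : ℕ) where
  g : SpacetimePt n → Fin n → Fin n → ℝ
  g_contDiff : ContDiff ℝ 1 g
  g_symm : ∀ p i j, g p i j = g p j i
  g_lorentz : ∀ p : SpacetimePt n, ∃ L : (Fin n → ℝ) ≃ₗ[ℝ] (Fin n → ℝ),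
    ∀ i j, bilForm (g p) (L (Pi.single i 1)) (L (Pi.single j 1)) = minkowskiMatrix n i j
  X0 : SpacetimePt n → Fin n → ℝ
  X0_cont : Continuous X0
  X0_timelike : ∀ p, bilForm (g p) (X0 p) (X0 p) < 0

namespace C1Spacetime

variable {n : ℕ} (M : C1Spacetime n)

/-- The inverse metric. -/
def ginv (p : SpacetimePt n) : Matrix (Fin n) (Fin n) ℝ :=
  (Matrix.of (M.g p))⁻¹

/-- Christoffel symbols Γᵏᵢⱼ = ½ Σ_l gᵏˡ(∂ᵢ g_{jl} + ∂ⱼ g_{il} − ∂_l g_{ij}). -/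
def christoffel (k i j : Fin n) (p : SpacetimePt n) : ℝ :=
  (1 / 2) * ∑ l, M.ginv p k l *
    (fderiv ℝ (fun q => M.g q j l) p (Pi.single i 1)
      + fderiv ℝ (fun q => M.g q i l) p (Pi.single j 1)
      - fderiv ℝ (fun q => M.g q i j) p (Pi.single l 1))

/-- A geodesic on the interval `I` : a C² curve satisfying the geodesic equation. -/
def IsGeodesicOn (γ : ℝ → SpacetimePt n) (I : Set ℝ) : Prop :=
  ContDiffOn ℝ 2 γ I ∧ ∀ t ∈ I, ∀ k,
    derivWithin (fun s => derivWithin γ I s k) I t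
      + ∑ i, ∑ j, M.christoffel k i j (γ t) *
          derivWithin γ I t i * derivWithin γ I t j = 0

/-- `v` is a causal vector at `p`. -/
def CausalVec (p v : SpacetimePt n) : Prop := v ≠ 0 ∧ bilForm (M.g p) v v ≤ 0

/-- `v` is a timelike vector at `p`. -/
def TimelikeVec (p v : SpacetimePt n) : Prop := bilForm (M.g p) v v < 0

/-- A causal vector `v` at `p` is future-directed. -/
def FdVec (p v : SpacetimePt n) : Prop := bilForm (M.g p) v (M.X0 p) < 0

/-- A causal vector `v` at `p` is past-directed. -/
def PdVec (p v : SpacetimePt n) : Prop := 0 < bilForm (M.g p) v (M.X0 p)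

/-- A causal geodesic on `I`: the velocity is everywhere causal. -/
def IsCausalGeodesicOn (γ : ℝ → SpacetimePt n) (I : Set ℝ) : Prop :=
  M.IsGeodesicOn γ I ∧ ∀ t ∈ I, M.CausalVec (γ t) (derivWithin γ I t)

/-- A future-directed causal geodesic on `I`. -/
def IsFdCausalGeodesicOn (γ : ℝ → SpacetimePt n) (I : Set ℝ) : Prop :=
  M.IsGeodesicOn γ I ∧ ∀ t ∈ I,
    M.CausalVec (γ t) (derivWithin γ I t) ∧ M.FdVec (γ t) (derivWithin γ I t)

/-- A past-directed causal geodesic on `I`. -/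
def IsPdCausalGeodesicOn (γ : ℝ → SpacetimePt n) (I : Set ℝ) : Prop :=
  M.IsGeodesicOn γ I ∧ ∀ t ∈ I,
    M.CausalVec (γ t) (derivWithin γ I t) ∧ M.PdVec (γ t) (derivWithin γ I t)

/-- A geodesic `γ : [a,b] → ℝⁿ` branches at `t₀ ∈ (a,b)`. -/
def BranchesAt (γ : ℝ → SpacetimePt n) (a b t₀ : ℝ) : Prop :=
  ∃ ε > 0, a ≤ t₀ - ε ∧ t₀ + ε ≤ b ∧
    ∃ σ : ℝ → SpacetimePt n, M.IsGeodesicOn σ (Ioo (t₀ - ε) (t₀ + ε)) ∧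
      (∀ t ∈ Ioc (t₀ - ε) t₀, γ t = σ t) ∧
      (γ '' Ioo t₀ (t₀ + ε)) ∩ (σ '' Ioo t₀ (t₀ + ε)) = ∅

/-- No causal geodesic branches. -/
def CausallyNonBranching : Prop :=
  ∀ (γ : ℝ → SpacetimePt n) (a b : ℝ), a < b → M.IsCausalGeodesicOn γ (Icc a b) →
    ∀ t₀ ∈ Ioo a b, ¬ M.BranchesAt γ a b t₀

/-- Non-intertwining. -/
def NonIntertwining : Prop :=
  ∀ p : SpacetimePt n, ∃ U ∈ 𝓝 p, ∀ ε : ℝ, 0 < ε → ∀ γ₁ γ₂ : ℝ → SpacetimePt n,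
    M.IsCausalGeodesicOn γ₁ (Icc 0 ε) → M.IsCausalGeodesicOn γ₂ (Icc 0 ε) →
    (∀ t ∈ Icc (0:ℝ) ε, γ₁ t ∈ U) → (∀ t ∈ Icc (0:ℝ) ε, γ₂ t ∈ U) →
    γ₁ 0 = p → γ₂ 0 = p →
    derivWithin γ₁ (Icc 0 ε) 0 = derivWithin γ₂ (Icc 0 ε) 0 →
    (∀ t ∈ Icc (0:ℝ) ε, γ₁ t = γ₂ t) ∨
      ¬ ∃ z : SpacetimePt n, AccPt z (𝓟 ((γ₁ '' Ioc 0 ε) ∩ (γ₂ '' Ioc 0 ε)))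

/-- Domain of the causal exponential map at `p`. -/
def ExpDomain (p : SpacetimePt n) : Set (SpacetimePt n) :=
  {v | bilForm (M.g p) v v ≤ 0 ∧
    ∃ γ : ℝ → SpacetimePt n, M.IsCausalGeodesicOn γ (Icc 0 1) ∧ γ 0 = p ∧
      derivWithin γ (Icc 0 1) 0 = v}

/-- A future-directed causal path on the interval `I`: locally Lipschitz with almost
everywhere future-directed causal derivative. -/
def IsFdCausalPathOn (γ : ℝ → SpacetimePt n) (I : Set ℝ) : Prop :=
  I.OrdConnected ∧ I.Nonempty ∧
    (∀ t ∈ I, ∃ K : ℝ≥0, ∃ U ∈ 𝓝[I] t, LipschitzOnWith K γ U) ∧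
    ∀ᵐ t ∂(volume.restrict I), DifferentiableAt ℝ γ t ∧
      M.CausalVec (γ t) (deriv γ t) ∧ M.FdVec (γ t) (deriv γ t)

/-- A future-directed timelike path on the interval `I`. -/
def IsFdTimelikePathOn (γ : ℝ → SpacetimePt n) (I : Set ℝ) : Prop :=
  I.OrdConnected ∧ I.Nonempty ∧
    (∀ t ∈ I, ∃ K : ℝ≥0, ∃ U ∈ 𝓝[I] t, LipschitzOnWith K γ U) ∧
    ∀ᵐ t ∂(volume.restrict I), DifferentiableAt ℝ γ t ∧
      M.TimelikeVec (γ t) (deriv γ t) ∧ M.FdVec (γ t) (deriv γ t)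

/-- Chronological relation `p ≪ q`. -/
def chron (p q : SpacetimePt n) : Prop :=
  ∃ (γ : ℝ → SpacetimePt n) (a b : ℝ), a < b ∧ M.IsFdTimelikePathOn γ (Icc a b) ∧
    γ a = p ∧ γ b = q

/-- Causal relation `p ≤ q`. -/
def causalLe (p q : SpacetimePt n) : Prop :=
  p = q ∨ ∃ (γ : ℝ → SpacetimePt n) (a b : ℝ), a < b ∧ M.IsFdCausalPathOn γ (Icc a b) ∧
    γ a = p ∧ γ b = q

/-- g-length of a causal path on `[a,b]`. -/
def gLength (γ : ℝ → SpacetimePt n) (a b : ℝ) : ℝ :=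
  ∫ t in a..b, Real.sqrt (- bilForm (M.g (γ t)) (deriv γ t) (deriv γ t))

/-- Lorentzian distance. -/
def ldist (p q : SpacetimePt n) : ℝ≥0∞ :=
  ⨆ (γ : ℝ → SpacetimePt n) (a : ℝ) (b : ℝ) (_ : a < b)
    (_ : M.IsFdCausalPathOn γ (Icc a b)) (_ : γ a = p) (_ : γ b = q),
    ENNReal.ofReal (M.gLength γ a b)

/-- Non-total imprisonment: no future or past inextendible causal curve is contained
in a compact set (inextendible = no limit at the open end). -/
def NonImprisoning : Prop :=
  ∀ K : Set (SpacetimePt n), IsCompact K →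
    (∀ (a b : ℝ) (γ : ℝ → SpacetimePt n), M.IsFdCausalPathOn γ (Ico a b) →
      (¬ ∃ q, Tendsto γ (𝓝[<] b) (𝓝 q)) → ¬ ∀ t ∈ Ico a b, γ t ∈ K) ∧
    (∀ (a : ℝ) (γ : ℝ → SpacetimePt n), M.IsFdCausalPathOn γ (Ici a) →
      (¬ ∃ q, Tendsto γ atTop (𝓝 q)) → ¬ ∀ t ∈ Ici a, γ t ∈ K) ∧
    (∀ (a b : ℝ) (γ : ℝ → SpacetimePt n), M.IsFdCausalPathOn γ (Ioc a b) →
      (¬ ∃ q, Tendsto γ (𝓝[>] a) (𝓝 q)) → ¬ ∀ t ∈ Ioc a b, γ t ∈ K) ∧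
    (∀ (b : ℝ) (γ : ℝ → SpacetimePt n), M.IsFdCausalPathOn γ (Iic b) →
      (¬ ∃ q, Tendsto γ atBot (𝓝 q)) → ¬ ∀ t ∈ Iic b, γ t ∈ K)

/-- Global hyperbolicity. -/
def GloballyHyperbolic : Prop :=
  M.NonImprisoning ∧
    ∀ p q : SpacetimePt n, IsCompact {z : SpacetimePt n | M.causalLe p z ∧ M.causalLe z q}

/-- Finite compactness. -/
def FinitelyCompact : Prop :=
  ∀ B : ℝ, 0 < B → ∀ p q : SpacetimePt n, ∀ x : ℕ → SpacetimePt n,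
    ((∀ m, M.chron p q ∧ M.causalLe q (x m) ∧ M.ldist p (x m) ≤ ENNReal.ofReal B) →
      ∃ z : SpacetimePt n, MapClusterPt z atTop x) ∧
    ((∀ m, M.causalLe (x m) q ∧ M.chron q p ∧ M.ldist (x m) p ≤ ENNReal.ofReal B) →
      ∃ z : SpacetimePt n, MapClusterPt z atTop x)

/-- Timelike Cauchy completeness. -/
def TimelikeCauchyComplete : Prop :=
  ∀ (x : ℕ → SpacetimePt n) (B : ℕ → ℝ), (∀ m, 0 ≤ B m) → Tendsto B atTop (𝓝 0) →
    (((∀ m, M.chron (x m) (x (m + 1))) ∧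
        ∀ k m : ℕ, 0 < m → M.ldist (x k) (x (k + m)) ≤ ENNReal.ofReal (B k)) ∨
      ((∀ m, M.chron (x (m + 1)) (x m)) ∧
        ∀ k m : ℕ, 0 < m → M.ldist (x (k + m)) (x k) ≤ ENNReal.ofReal (B k))) →
    ∃ l : SpacetimePt n, Tendsto x atTop (𝓝 l)

/-- Condition A for C¹-spacetimes: for `x ≪ y` and every future inextendible
future-directed causal geodesic starting at `y` defined on `[0,c)` (`c ∈ (0,∞]`),
the Lorentzian distance `T(x, γ(t))` tends to infinity as `t → c`; dually for the past. -/
def ConditionA : Prop :=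
  (∀ x y : SpacetimePt n, M.chron x y →
    (∀ c : ℝ, 0 < c → ∀ γ : ℝ → SpacetimePt n, M.IsFdCausalGeodesicOn γ (Ico 0 c) →
      γ 0 = y → (¬ ∃ z, Tendsto γ (𝓝[<] c) (𝓝 z)) →
      Tendsto (fun t => M.ldist x (γ t)) (𝓝[<] c) (𝓝 ⊤)) ∧
    (∀ γ : ℝ → SpacetimePt n, M.IsFdCausalGeodesicOn γ (Ici 0) →
      γ 0 = y → (¬ ∃ z, Tendsto γ atTop (𝓝 z)) →
      Tendsto (fun t => M.ldist x (γ t)) atTop (𝓝 ⊤))) ∧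
  (∀ x y : SpacetimePt n, M.chron y x →
    (∀ c : ℝ, 0 < c → ∀ γ : ℝ → SpacetimePt n, M.IsPdCausalGeodesicOn γ (Ico 0 c) →
      γ 0 = y → (¬ ∃ z, Tendsto γ (𝓝[<] c) (𝓝 z)) →
      Tendsto (fun t => M.ldist (γ t) x) (𝓝[<] c) (𝓝 ⊤)) ∧
    (∀ γ : ℝ → SpacetimePt n, M.IsPdCausalGeodesicOn γ (Ici 0) →
      γ 0 = y → (¬ ∃ z, Tendsto γ atTop (𝓝 z)) →
      Tendsto (fun t => M.ldist (γ t) x) atTop (𝓝 ⊤)))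

end C1Spacetime

section BilinearForm

variable {n : ℕ}

theorem bilForm_add_left (A : Fin n → Fin n → ℝ) (u u' v : Fin n → ℝ) :
    bilForm A (u + u') v = bilForm A u v + bilForm A u' v := by
  simp only [bilForm, Pi.add_apply, ← Finset.sum_add_distrib]
  exact Finset.sum_congr rfl fun i _ => Finset.sum_congr rfl fun j _ => by ring

theorem bilForm_add_right (A : Fin n → Fin n → ℝ) (u v v' : Fin n → ℝ) :
    bilForm A u (v + v') = bilForm A u v + bilForm A u v' := by
  simp only [bilForm, Pi.add_apply, ← Finset.sum_add_distrib]
  exact Finset.sum_congr rfl fun i _ => Finset.sum_congr rfl fun j _ => by ring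

theorem bilForm_smul_left (A : Fin n → Fin n → ℝ) (c : ℝ) (u v : Fin n → ℝ) :
    bilForm A (c • u) v = c * bilForm A u v := by
  simp only [bilForm, Pi.smul_apply, smul_eq_mul, Finset.mul_sum]
  exact Finset.sum_congr rfl fun i _ => Finset.sum_congr rfl fun j _ => by ring

theorem bilForm_smul_right (A : Fin n → Fin n → ℝ) (c : ℝ) (u v : Fin n → ℝ) :
    bilForm A u (c • v) = c * bilForm A u v := by
  simp only [bilForm, Pi.smul_apply, smul_eq_mul, Finset.mul_sum]
  exact Finset.sum_congr rfl fun i _ => Finset.sum_congr rfl fun j _ => by ring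

theorem bilForm_sub_coeff (A B : Fin n → Fin n → ℝ) (u v : Fin n → ℝ) :
    bilForm (A - B) u v = bilForm A u v - bilForm B u v := by
  simp only [bilForm, Pi.sub_apply, ← Finset.sum_sub_distrib]
  exact Finset.sum_congr rfl fun i _ => Finset.sum_congr rfl fun j _ => by ring

theorem bilForm_symm {A : Fin n → Fin n → ℝ} (hA : ∀ i j, A i j = A j i) (u v : Fin n → ℝ) :
    bilForm A u v = bilForm A v u := by
  simp only [bilForm]
  rw [Finset.sum_comm]
  exact Finset.sum_congr rfl fun i _ => Finset.sum_congr rfl fun j _ => by rw [hA j i]; ring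

theorem abs_bilForm_le (A : Fin n → Fin n → ℝ) (u v : Fin n → ℝ) :
    |bilForm A u v| ≤ (n : ℝ) ^ 2 * ‖A‖ * ‖u‖ * ‖v‖ := by
  have h : ∀ i j, |A i j * u i * v j| ≤ ‖A‖ * ‖u‖ * ‖v‖ := fun i j => by
    rw [abs_mul, abs_mul]
    have h1 : |A i j| ≤ ‖A‖ := (norm_le_pi_norm (A i) j).trans (norm_le_pi_norm A i)
    have h2 : |u i| ≤ ‖u‖ := norm_le_pi_norm u i
    have h3 : |v j| ≤ ‖v‖ := norm_le_pi_norm v j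
    gcongr
  calc |bilForm A u v| ≤ ∑ i : Fin n, |∑ j, A i j * u i * v j| := Finset.abs_sum_le_sum_abs _ _
    _ ≤ ∑ i : Fin n, ∑ j : Fin n, |A i j * u i * v j| :=
        Finset.sum_le_sum fun i _ => Finset.abs_sum_le_sum_abs _ _
    _ ≤ ∑ _i : Fin n, ∑ _j : Fin n, ‖A‖ * ‖u‖ * ‖v‖ :=
        Finset.sum_le_sum fun i _ => Finset.sum_le_sum fun j _ => h i j
    _ = _ := by simp; ring

theorem continuous_bilForm {X : Type*} [TopologicalSpace X] {A : X → Fin n → Fin n → ℝ}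
    {u v : X → Fin n → ℝ} (hA : Continuous A) (hu : Continuous u) (hv : Continuous v) :
    Continuous fun z => bilForm (A z) (u z) (v z) := by
  unfold bilForm
  fun_prop

theorem bilForm_basis_expansion (A : Fin n → Fin n → ℝ)
    (L : (Fin n → ℝ) →ₗ[ℝ] (Fin n → ℝ)) (a b : Fin n → ℝ) :
    bilForm A (L a) (L b) =
      ∑ i, ∑ j, a i * b j * bilForm A (L (Pi.single i 1)) (L (Pi.single j 1)) := by
  have hsum : ∀ a : Fin n → ℝ, L a = ∑ i, a i • L (Pi.single i 1) := fun a => by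
    conv_lhs => rw [pi_eq_sum_univ' a]
    simp [map_sum]
  have hl : ∀ (s : Finset (Fin n)) (f : Fin n → Fin n → ℝ) (w : Fin n → ℝ),
      bilForm A (∑ i ∈ s, f i) w = ∑ i ∈ s, bilForm A (f i) w := fun s f w => by
    induction s using Finset.induction_on with
    | empty => simp [bilForm]
    | insert i s hi ih => rw [Finset.sum_insert hi, Finset.sum_insert hi, bilForm_add_left, ih]
  have hr : ∀ (s : Finset (Fin n)) (f : Fin n → Fin n → ℝ) (w : Fin n → ℝ),
      bilForm A w (∑ i ∈ s, f i) = ∑ i ∈ s, bilForm A w (f i) := fun s f w => by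
    induction s using Finset.induction_on with
    | empty => simp [bilForm]
    | insert i s hi ih => rw [Finset.sum_insert hi, Finset.sum_insert hi, bilForm_add_right, ih]
  rw [hsum a, hsum b, hl]
  refine Finset.sum_congr rfl fun i _ => ?_
  rw [hr]
  refine Finset.sum_congr rfl fun j _ => ?_
  rw [bilForm_smul_left, bilForm_smul_right]
  ring

/-- The orthogonal complement of a timelike vector is spacelike. -/
theorem bilForm_pos_of_orthogonal {A : Fin n → Fin n → ℝ}
    (hA : ∃ L : (Fin n → ℝ) ≃ₗ[ℝ] (Fin n → ℝ),
      ∀ i j, bilForm A (L (Pi.single i 1)) (L (Pi.single j 1)) = minkowskiMatrix n i j)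
    {X v : Fin n → ℝ} (hX : bilForm A X X < 0) (hv : v ≠ 0) (hXv : bilForm A v X = 0) :
    0 < bilForm A v v := by
  obtain ⟨L, hL⟩ := hA
  obtain _ | m := n
  · simp [bilForm] at hX
  have key : ∀ a b : Fin (m + 1) → ℝ, bilForm A (L a) (L b) =
      -(a 0 * b 0) + ∑ i : Fin m, a i.succ * b i.succ := fun a b => by
    have := bilForm_basis_expansion A L.toLinearMap a b
    simp only [LinearEquiv.coe_coe, hL] at this
    rw [this, Fin.sum_univ_succ]
    simp [minkowskiMatrix, Finset.sum_ite_eq]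
  obtain ⟨a, rfl⟩ := L.surjective X
  obtain ⟨b, rfl⟩ := L.surjective v
  have hb : b ≠ 0 := fun h => hv (by simp [h])
  rw [key] at hX hXv ⊢
  have cs := Finset.sum_mul_sq_le_sq_mul_sq Finset.univ (fun i : Fin m => b i.succ)
    (fun i : Fin m => a i.succ)
  have ha : ∑ i : Fin m, a i.succ * a i.succ = ∑ i : Fin m, a i.succ ^ 2 := by simp only [sq]
  have hbb : ∑ i : Fin m, b i.succ * b i.succ = ∑ i : Fin m, b i.succ ^ 2 := by simp only [sq]
  rw [ha] at hX
  rw [hbb]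
  have h1 : ∑ i : Fin m, b i.succ * a i.succ = b 0 * a 0 := by linarith
  rw [h1] at cs
  have hPa : 0 ≤ ∑ i : Fin m, a i.succ ^ 2 := Finset.sum_nonneg fun i _ => sq_nonneg _
  have hPb : 0 ≤ ∑ i : Fin m, b i.succ ^ 2 := Finset.sum_nonneg fun i _ => sq_nonneg _
  by_contra hcon
  push Not at hcon
  have hb0 : b 0 = 0 := by
    by_contra hne
    have : 0 < b 0 ^ 2 := by positivity
    nlinarith
  have hs : ∑ i : Fin m, b i.succ ^ 2 = 0 := by nlinarith
  rw [Finset.sum_eq_zero_iff_of_nonneg fun i _ => sq_nonneg _] at hs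
  apply hb
  ext i
  refine Fin.cases hb0 (fun j => ?_) i
  simpa using hs j (Finset.mem_univ j)

end BilinearForm

namespace C1Spacetime

variable {n : ℕ} (M : C1Spacetime n)

theorem continuous_g : Continuous M.g := M.g_contDiff.continuous

theorem bilForm_comm (p u v : SpacetimePt n) :
    bilForm (M.g p) u v = bilForm (M.g p) v u :=
  bilForm_symm (M.g_symm p) u v

theorem fdVec_of_nonpos {p v : SpacetimePt n} (hv : M.CausalVec p v)
    (h : bilForm (M.g p) v (M.X0 p) ≤ 0) : M.FdVec p v := by
  refine lt_of_le_of_ne h fun h0 => ?_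
  exact absurd hv.2 (not_le.2 (bilForm_pos_of_orthogonal (M.g_lorentz p) (M.X0_timelike p) hv.1 h0))

theorem CausalVec.smul {M : C1Spacetime n} {p v : SpacetimePt n} (hv : M.CausalVec p v) {c : ℝ}
    (hc : 0 < c) : M.CausalVec p (c • v) := by
  refine ⟨smul_ne_zero hc.ne' hv.1, ?_⟩
  rw [bilForm_smul_left, bilForm_smul_right]
  exact mul_nonpos_of_nonneg_of_nonpos hc.le (mul_nonpos_of_nonneg_of_nonpos hc.le hv.2)

theorem FdVec.smul {M : C1Spacetime n} {p v : SpacetimePt n} (hv : M.FdVec p v) {c : ℝ}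
    (hc : 0 < c) : M.FdVec p (c • v) := by
  unfold FdVec
  rw [bilForm_smul_left]
  exact mul_neg_of_pos_of_neg hc hv

theorem eventually_bilForm_X0_neg (x : SpacetimePt n) :
    ∀ᶠ y in 𝓝 x, ∀ v, M.CausalVec y v → M.FdVec y v → bilForm (M.g y) v (M.X0 x) < 0 := by
  have h : ∀ᶠ y in 𝓝 x, ∀ u ∈ Metric.sphere (0 : SpacetimePt n) 1,
      0 < bilForm (M.g y) u u ∨ 0 < bilForm (M.g y) u (M.X0 y) ∨
        bilForm (M.g y) u (M.X0 x) < 0 := by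
    refine (isCompact_sphere _ _).eventually_forall_of_forall_eventually fun u hu => ?_
    have hu0 : u ≠ 0 := by
      rintro rfl
      simp at hu
    have c1 : Continuous fun z : SpacetimePt n × SpacetimePt n => bilForm (M.g z.1) z.2 z.2 :=
      continuous_bilForm (M.continuous_g.comp continuous_fst) continuous_snd continuous_snd
    have c2 : Continuous fun z : SpacetimePt n × SpacetimePt n =>
        bilForm (M.g z.1) z.2 (M.X0 z.1) :=
      continuous_bilForm (M.continuous_g.comp continuous_fst) continuous_snd
        (M.X0_cont.comp continuous_fst)
    have c3 : Continuous fun z : SpacetimePt n × SpacetimePt n =>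
        bilForm (M.g z.1) z.2 (M.X0 x) :=
      continuous_bilForm (M.continuous_g.comp continuous_fst) continuous_snd continuous_const
    rcases lt_trichotomy (bilForm (M.g x) u (M.X0 x)) 0 with h | h | h
    · filter_upwards [(isOpen_lt c3 continuous_const).mem_nhds (x := (x, u)) h] with z hz
      exact Or.inr (Or.inr hz)
    · have := bilForm_pos_of_orthogonal (M.g_lorentz x) (M.X0_timelike x) hu0 h
      filter_upwards [(isOpen_lt continuous_const c1).mem_nhds (x := (x, u)) this] with z hz
      exact Or.inl hz
    · filter_upwards [(isOpen_lt continuous_const c2).mem_nhds (x := (x, u)) h] with z hz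
      exact Or.inr (Or.inl hz)
  filter_upwards [h] with y hy v hv hf
  have hpos : 0 < ‖v‖ := norm_pos_iff.2 hv.1
  have hi : 0 < ‖v‖⁻¹ := inv_pos.2 hpos
  have hu : ‖v‖⁻¹ • v ∈ Metric.sphere (0 : SpacetimePt n) 1 := by
    simp [norm_smul, hpos.ne']
  rcases hy _ hu with h | h | h
  · exact absurd (hv.smul hi).2 (not_le.2 h)
  · exact absurd (hf.smul hi) (not_lt.2 h.le)
  · rw [bilForm_smul_left] at h
    exact not_le.1 fun hcon => absurd h (not_lt.2 (mul_nonneg hi.le hcon))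

/-- There is a smooth vector field which pairs negatively with every future-directed causal
vector. -/
theorem exists_contDiff_timeField : ∃ W : SpacetimePt n → SpacetimePt n, ContDiff ℝ 1 W ∧
    ∀ y v, M.CausalVec y v → M.FdVec y v → bilForm (M.g y) v (W y) < 0 := by
  obtain ⟨W, hW⟩ := exists_contMDiffMap_forall_mem_convex_of_local_const
    (I := modelWithCornersSelf ℝ (SpacetimePt n)) (M := SpacetimePt n) (F := SpacetimePt n) (n := 1)
    (t := fun y => {w | ∀ v, M.CausalVec y v → M.FdVec y v → bilForm (M.g y) v w < 0})
    (fun y w₁ h₁ w₂ h₂ a b ha hb hab v hv hf => by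
      rw [bilForm_add_right, bilForm_smul_right, bilForm_smul_right]
      have := h₁ v hv hf
      have := h₂ v hv hf
      rcases ha.eq_or_lt with rfl | ha
      · have : b = 1 := by linarith
        subst this
        linarith
      · nlinarith)
    (fun x => ⟨M.X0 x, M.eventually_bilForm_X0_neg x⟩)
  exact ⟨W, contMDiff_iff_contDiff.1 W.contMDiff, fun y v => hW y v⟩

/-- Unit future-directed causal vectors based in a closed ball. -/
def unitCone (R : ℝ) : Set (SpacetimePt n × SpacetimePt n) :=
  {z | z.1 ∈ Metric.closedBall 0 R ∧ z.2 ∈ Metric.sphere 0 1 ∧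
    bilForm (M.g z.1) z.2 z.2 ≤ 0 ∧ bilForm (M.g z.1) z.2 (M.X0 z.1) ≤ 0}

theorem continuous_pairing {W : SpacetimePt n → SpacetimePt n} (hW : Continuous W) :
    Continuous fun z : SpacetimePt n × SpacetimePt n => bilForm (M.g z.1) z.2 (W z.1) :=
  continuous_bilForm (M.continuous_g.comp continuous_fst) continuous_snd (hW.comp continuous_fst)

theorem isCompact_unitCone (R : ℝ) : IsCompact (M.unitCone R) := by
  have h1 : IsClosed {z : SpacetimePt n × SpacetimePt n | bilForm (M.g z.1) z.2 z.2 ≤ 0} :=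
    isClosed_le (continuous_bilForm (M.continuous_g.comp continuous_fst) continuous_snd
      continuous_snd) continuous_const
  have h2 := isClosed_le (M.continuous_pairing M.X0_cont) (continuous_const (y := (0 : ℝ)))
  have := ((isCompact_closedBall (0 : SpacetimePt n) R).prod
    (isCompact_sphere (0 : SpacetimePt n) 1)).inter_right (h1.inter h2)
  refine this.of_isClosed_subset ?_ fun z hz => ⟨⟨hz.1, hz.2.1⟩, hz.2.2⟩
  convert this.isClosed using 1
  ext z
  exact ⟨fun hz => ⟨⟨hz.1, hz.2.1⟩, hz.2.2⟩, fun hz => ⟨hz.1.1, hz.1.2, hz.2⟩⟩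

theorem mem_unitCone {R : ℝ} {y u : SpacetimePt n} (hy : y ∈ Metric.closedBall 0 R)
    (hu : ‖u‖ = 1) (hc : M.CausalVec y u) (hf : M.FdVec y u) : (y, u) ∈ M.unitCone R :=
  ⟨hy, by simpa using hu, hc.2, le_of_lt hf⟩

theorem causal_fd_of_mem_unitCone {R : ℝ} {z : SpacetimePt n × SpacetimePt n}
    (hz : z ∈ M.unitCone R) : M.CausalVec z.1 z.2 ∧ M.FdVec z.1 z.2 := by
  have hc : M.CausalVec z.1 z.2 := by
    refine ⟨fun h0 => ?_, hz.2.2.1⟩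
    have := hz.2.1
    simp [h0] at this
  exact ⟨hc, M.fdVec_of_nonpos hc hz.2.2.2⟩

theorem exists_pairing_lower_bound {W : SpacetimePt n → SpacetimePt n} (hW : Continuous W)
    (hWn : ∀ y v, M.CausalVec y v → M.FdVec y v → bilForm (M.g y) v (W y) < 0) (R : ℝ) :
    ∃ c > 0, ∀ y ∈ Metric.closedBall (0 : SpacetimePt n) R, ∀ v, M.CausalVec y v → M.FdVec y v →
      c * ‖v‖ ≤ - bilForm (M.g y) v (W y) := by
  have hcont : Continuous fun z : SpacetimePt n × SpacetimePt n =>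
      - bilForm (M.g z.1) z.2 (W z.1) := (M.continuous_pairing hW).neg
  obtain ⟨c, hc, hcb⟩ := (M.isCompact_unitCone R).exists_forall_le' (a := (0 : ℝ))
    hcont.continuousOn (fun z hz => by
      have := M.causal_fd_of_mem_unitCone hz
      have := hWn _ _ this.1 this.2
      linarith)
  refine ⟨c, hc, fun y hy v hv hf => ?_⟩
  have hpos : 0 < ‖v‖ := norm_pos_iff.2 hv.1
  have hi : 0 < ‖v‖⁻¹ := inv_pos.2 hpos
  have := hcb (y, ‖v‖⁻¹ • v) (M.mem_unitCone hy (by simp [norm_smul, hpos.ne']) (hv.smul hi)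
    (hf.smul hi))
  simp only [bilForm_smul_left] at this
  calc c * ‖v‖ ≤ -(‖v‖⁻¹ * bilForm (M.g y) v (W y)) * ‖v‖ := by gcongr
    _ = _ := by field_simp

theorem exists_fd_radius (R : ℝ) : ∃ ρ > 0, ∀ y ∈ Metric.closedBall (0 : SpacetimePt n) R,
    ∀ u, ‖u‖ = 1 → M.CausalVec y u → M.FdVec y u → ∀ y' u', ‖y' - y‖ < ρ → ‖u' - u‖ < ρ →
      M.FdVec y' u' := by
  have hopen : IsOpen {z : SpacetimePt n × SpacetimePt n | bilForm (M.g z.1) z.2 (M.X0 z.1) < 0} :=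
    isOpen_lt (M.continuous_pairing M.X0_cont) continuous_const
  obtain ⟨ρ, hρ, hsub⟩ := (M.isCompact_unitCone R).exists_thickening_subset_open hopen
    fun z hz => (M.causal_fd_of_mem_unitCone hz).2
  refine ⟨ρ, hρ, fun y hy u hu hc hf y' u' hy' hu' => ?_⟩
  refine hsub (Metric.mem_thickening_iff.2 ⟨(y, u), M.mem_unitCone hy hu hc hf, ?_⟩ :
    (y', u') ∈ _)
  rw [Prod.dist_eq, max_lt_iff, dist_eq_norm, dist_eq_norm]
  exact ⟨hy', hu'⟩

end C1Spacetime

namespace C1Spacetime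

variable {n : ℕ} (M : C1Spacetime n)

/-- A globally Lipschitz curve which is future-directed causal at almost every time of `(a, b)`. -/
def IsLipPath (γ : ℝ → SpacetimePt n) (a b : ℝ) : Prop :=
  (∃ K : ℝ≥0, LipschitzWith K γ) ∧ ∀ᵐ t, t ∈ Ioo a b → DifferentiableAt ℝ γ t ∧
    M.CausalVec (γ t) (deriv γ t) ∧ M.FdVec (γ t) (deriv γ t)

/-- The coordinate arclength of a curve. -/
def arcLen (γ : ℝ → SpacetimePt n) (a b : ℝ) : ℝ := ∫ t in a..b, ‖deriv γ t‖

variable {M}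

theorem IsLipPath.continuous {γ : ℝ → SpacetimePt n} {a b : ℝ} (h : M.IsLipPath γ a b) :
    Continuous γ := by
  obtain ⟨K, hK⟩ := h.1
  exact hK.continuous

theorem IsLipPath.mono {γ : ℝ → SpacetimePt n} {a b c d : ℝ} (h : M.IsLipPath γ a b)
    (hac : a ≤ c) (hdb : d ≤ b) : M.IsLipPath γ c d :=
  ⟨h.1, h.2.mono fun _ ht htm => ht ⟨hac.trans_lt htm.1, htm.2.trans_le hdb⟩⟩

theorem IsLipPath.isFdCausalPathOn {γ : ℝ → SpacetimePt n} {a b : ℝ} (h : M.IsLipPath γ a b)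
    (hab : a < b) : M.IsFdCausalPathOn γ (Icc a b) := by
  obtain ⟨⟨K, hK⟩, hae⟩ := h
  refine ⟨ordConnected_Icc, nonempty_Icc.2 hab.le,
    fun t _ => ⟨K, univ, univ_mem, hK.lipschitzOnWith⟩, ?_⟩
  rw [← restrict_Ioo_eq_restrict_Icc]
  exact (ae_restrict_iff' measurableSet_Ioo).2 hae

theorem deriv_eq_of_eqOn_Ioo {γ γ' : ℝ → SpacetimePt n} {a b : ℝ} (h : EqOn γ γ' (Ioo a b))
    {t : ℝ} (ht : t ∈ Ioo a b) : γ =ᶠ[𝓝 t] γ' :=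
  Filter.eventuallyEq_of_mem (Ioo_mem_nhds ht.1 ht.2) h

theorem gLength_congr {γ γ' : ℝ → SpacetimePt n} {a b : ℝ} (hab : a ≤ b)
    (h : EqOn γ γ' (Ioo a b)) : M.gLength γ a b = M.gLength γ' a b := by
  unfold gLength
  rw [intervalIntegral.integral_of_le hab, intervalIntegral.integral_of_le hab,
    integral_Ioc_eq_integral_Ioo, integral_Ioc_eq_integral_Ioo]
  refine setIntegral_congr_fun measurableSet_Ioo fun t ht => ?_
  simp only [(deriv_eq_of_eqOn_Ioo h ht).deriv_eq, h ht]

theorem IsFdCausalPathOn.exists_isLipPath {γ : ℝ → SpacetimePt n} {a b : ℝ} (hab : a < b)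
    (h : M.IsFdCausalPathOn γ (Icc a b)) : ∃ γ', M.IsLipPath γ' a b ∧ EqOn γ γ' (Icc a b) ∧
      M.gLength γ' a b = M.gLength γ a b := by
  obtain ⟨-, -, hlip, hae⟩ := h
  have hloc : LocallyLipschitzOn (Icc a b) γ := fun t ht => hlip t ht
  obtain ⟨K, hK⟩ := hloc.exists_lipschitzOnWith_of_compact isCompact_Icc
  obtain ⟨γ', hγ', heq⟩ := hK.extend_pi
  have heq' : EqOn γ γ' (Ioo a b) := heq.mono Ioo_subset_Icc_self
  refine ⟨γ', ⟨⟨K, hγ'⟩, ?_⟩, heq, (gLength_congr hab.le heq').symm⟩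
  rw [← restrict_Ioo_eq_restrict_Icc, ae_restrict_iff' measurableSet_Ioo] at hae
  filter_upwards [hae] with t ht htm
  have he := deriv_eq_of_eqOn_Ioo heq' htm
  rw [← he.deriv_eq, ← heq' htm]
  exact ⟨(ht htm).1.congr_of_eventuallyEq he.symm, (ht htm).2⟩

/-- Affine reparametrisation of a causal curve. -/
theorem IsLipPath.comp_affine {γ : ℝ → SpacetimePt n} {a b : ℝ} (h : M.IsLipPath γ a b)
    {α : ℝ} (hα : 0 < α) (β : ℝ) {c d : ℝ} (hc : a ≤ α * c + β) (hd : α * d + β ≤ b) :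
    M.IsLipPath (fun t => γ (α * t + β)) c d := by
  obtain ⟨⟨K, hK⟩, hae⟩ := h
  have hlip : LipschitzWith ‖α‖₊ fun t : ℝ => α * t + β :=
    LipschitzWith.of_dist_le_mul fun s t => by
      simp [dist_eq_norm, ← mul_sub]
  refine ⟨⟨K * ‖α‖₊, hK.comp hlip⟩, ?_⟩
  have hq : Measure.QuasiMeasurePreserving (fun t : ℝ => α * t + β) volume volume := by
    refine ⟨by fun_prop, ?_⟩
    have h1 : (volume : Measure ℝ).map (fun t : ℝ => α * t + β) =
        ENNReal.ofReal |α⁻¹| • volume := by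
      have : (fun t : ℝ => α * t + β) = (fun t => t + β) ∘ fun t => α * t := rfl
      rw [this, ← Measure.map_map (by fun_prop) (by fun_prop), Real.map_volume_mul_left hα.ne',
        Measure.map_smul, map_add_right_eq_self]
    rw [h1]
    exact Measure.smul_absolutelyContinuous
  filter_upwards [hq.ae hae] with t ht htm
  have hmem : α * t + β ∈ Ioo a b :=
    ⟨hc.trans_lt (by have := mul_lt_mul_of_pos_left htm.1 hα; linarith),
      lt_of_lt_of_le (by have := mul_lt_mul_of_pos_left htm.2 hα; linarith) hd⟩
  obtain ⟨h1, h2, h3⟩ := ht hmem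
  have hd : HasDerivAt (fun t => γ (α * t + β)) (α • deriv γ (α * t + β)) t := by
    have := HasDerivAt.scomp (h := fun t : ℝ => α * t + β) (h' := α) t h1.hasDerivAt
      (by simpa using ((hasDerivAt_id t).const_mul α).add_const β)
    exact this
  rw [hd.deriv]
  exact ⟨hd.differentiableAt, h2.smul hα, h3.smul hα⟩

theorem gLength_comp_add (γ : ℝ → SpacetimePt n) (a b β : ℝ) :
    M.gLength (fun t => γ (1 * t + β)) (a - β) (b - β) = M.gLength γ a b := by
  unfold gLength
  have h : ∀ t, deriv (fun t => γ (t + β)) t = deriv γ (t + β) := deriv_comp_add_const γ β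
  simp only [one_mul, h]
  rw [intervalIntegral.integral_comp_add_right
    (fun t => √(-bilForm (M.g (γ t)) (deriv γ t) (deriv γ t)))]
  simp

/-- Concatenation of curves at time `b`. -/
def glue (γ₁ γ₂ : ℝ → SpacetimePt n) (b : ℝ) : ℝ → SpacetimePt n := fun t =>
  γ₁ (min t b) + (γ₂ (max t b) - γ₂ b)

theorem glue_of_le (γ₁ γ₂ : ℝ → SpacetimePt n) {b t : ℝ} (h : t ≤ b) :
    glue γ₁ γ₂ b t = γ₁ t := by
  simp [glue, h]

theorem glue_of_ge {γ₁ γ₂ : ℝ → SpacetimePt n} {b t : ℝ} (h12 : γ₁ b = γ₂ b) (h : b ≤ t) :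
    glue γ₁ γ₂ b t = γ₂ t := by
  simp [glue, h, h12]

theorem IsLipPath.glue {γ₁ γ₂ : ℝ → SpacetimePt n} {a b c : ℝ} (h₁ : M.IsLipPath γ₁ a b)
    (h₂ : M.IsLipPath γ₂ b c) (h12 : γ₁ b = γ₂ b) : M.IsLipPath (glue γ₁ γ₂ b) a c := by
  obtain ⟨⟨K₁, hK₁⟩, hae₁⟩ := h₁
  obtain ⟨⟨K₂, hK₂⟩, hae₂⟩ := h₂
  refine ⟨⟨_, (hK₁.comp (LipschitzWith.id.min_const b)).add
    ((hK₂.comp (LipschitzWith.id.max_const b)).sub (LipschitzWith.const _))⟩, ?_⟩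
  have hb : ∀ᵐ t : ℝ, t ≠ b := by simp [ae_iff, measure_singleton]
  filter_upwards [hae₁, hae₂, hb] with t ht₁ ht₂ htb htm
  rcases lt_or_gt_of_ne htb with hlt | hlt
  · have he : C1Spacetime.glue γ₁ γ₂ b =ᶠ[𝓝 t] γ₁ := by
      filter_upwards [Iio_mem_nhds hlt] with s hs using glue_of_le _ _ (le_of_lt hs)
    rw [he.deriv_eq, he.eq_of_nhds]
    have := ht₁ ⟨htm.1, hlt⟩
    exact ⟨this.1.congr_of_eventuallyEq he, this.2⟩
  · have he : C1Spacetime.glue γ₁ γ₂ b =ᶠ[𝓝 t] γ₂ := by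
      filter_upwards [Ioi_mem_nhds hlt] with s hs using glue_of_ge h12 (le_of_lt hs)
    rw [he.deriv_eq, he.eq_of_nhds]
    have := ht₂ ⟨hlt, htm.2⟩
    exact ⟨this.1.congr_of_eventuallyEq he, this.2⟩

theorem intervalIntegrable_of_measurable_bounded {f : ℝ → ℝ} (hf : Measurable f) {a b C : ℝ}
    (hC : ∀ t ∈ uIcc a b, |f t| ≤ C) : IntervalIntegrable f volume a b := by
  refine (intervalIntegrable_const (c := C)).mono_fun' hf.aestronglyMeasurable ?_
  filter_upwards [ae_restrict_mem measurableSet_uIoc] with t ht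
  exact hC t (uIoc_subset_uIcc ht)

theorem IsLipPath.intervalIntegrable_norm_deriv {γ : ℝ → SpacetimePt n} {a b : ℝ}
    (h : M.IsLipPath γ a b) (c d : ℝ) :
    IntervalIntegrable (fun t => ‖deriv γ t‖) volume c d := by
  obtain ⟨⟨K, hK⟩, -⟩ := h
  refine intervalIntegrable_of_measurable_bounded (measurable_deriv γ).norm (C := K) fun t _ => ?_
  rw [abs_norm]
  exact norm_deriv_le_of_lipschitz hK

theorem measurable_bilForm_deriv {γ : ℝ → SpacetimePt n} (hγ : Continuous γ) :
    Measurable fun t => bilForm (M.g (γ t)) (deriv γ t) (deriv γ t) := by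
  have hg : Continuous fun t => M.g (γ t) := M.continuous_g.comp hγ
  have hd : ∀ i, Measurable fun t => deriv γ t i := measurable_pi_iff.1 (measurable_deriv γ)
  unfold bilForm
  exact Finset.measurable_sum _ fun i _ => Finset.measurable_sum _ fun j _ =>
    ((by fun_prop : Continuous fun t => M.g (γ t) i j).measurable.mul (hd i)).mul (hd j)

theorem IsLipPath.intervalIntegrable_length {γ : ℝ → SpacetimePt n} {a b : ℝ}
    (h : M.IsLipPath γ a b) (c d : ℝ) :
    IntervalIntegrable (fun t => √(-bilForm (M.g (γ t)) (deriv γ t) (deriv γ t))) volume c d := by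
  have hc := h.continuous
  obtain ⟨⟨K, hK⟩, -⟩ := h
  obtain ⟨C, hC⟩ := (isCompact_uIcc (a := c) (b := d)).exists_bound_of_continuousOn
    (M.continuous_g.comp hc).continuousOn
  refine intervalIntegrable_of_measurable_bounded (measurable_bilForm_deriv hc).neg.sqrt
    (C := √((n : ℝ) ^ 2 * C * K * K)) fun t ht => ?_
  rw [abs_of_nonneg (Real.sqrt_nonneg _)]
  apply Real.sqrt_le_sqrt
  refine (neg_le_abs _).trans ((abs_bilForm_le _ _ _).trans ?_)
  have h1 : ‖M.g (γ t)‖ ≤ C := hC t ht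
  have h2 : ‖deriv γ t‖ ≤ K := norm_deriv_le_of_lipschitz hK
  have h3 : 0 ≤ C := (norm_nonneg _).trans h1
  gcongr

theorem IsLipPath.gLength_le_ldist {γ : ℝ → SpacetimePt n} {a b : ℝ} (h : M.IsLipPath γ a b)
    (hab : a < b) : ENNReal.ofReal (M.gLength γ a b) ≤ M.ldist (γ a) (γ b) := by
  unfold ldist
  refine le_iSup_of_le γ (le_iSup_of_le a (le_iSup_of_le b (le_iSup_of_le hab
    (le_iSup_of_le (h.isFdCausalPathOn hab) (le_iSup_of_le rfl (le_iSup_of_le rfl le_rfl))))))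

theorem ldist_le {p q : SpacetimePt n} {B : ℝ≥0∞} (h : ∀ γ a b, a < b → M.IsLipPath γ a b →
    γ a = p → γ b = q → ENNReal.ofReal (M.gLength γ a b) ≤ B) : M.ldist p q ≤ B := by
  unfold ldist
  refine iSup_le fun γ => iSup_le fun a => iSup_le fun b => iSup_le fun hab => iSup_le fun hγ =>
    iSup_le fun ha => iSup_le fun hb => ?_
  obtain ⟨γ', h', heq, hL⟩ := hγ.exists_isLipPath hab
  rw [← hL]
  exact h γ' a b hab h' ((heq ⟨le_rfl, hab.le⟩).symm.trans ha)
    ((heq ⟨hab.le, le_rfl⟩).symm.trans hb)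

/-- Causal curves with matching endpoints can be concatenated, and lengths add. -/
theorem IsLipPath.exists_trans {γ₁ γ₂ : ℝ → SpacetimePt n} {a b c d : ℝ} (hab : a < b)
    (hcd : c < d) (h₁ : M.IsLipPath γ₁ a b) (h₂ : M.IsLipPath γ₂ c d) (h12 : γ₁ b = γ₂ c) :
    ∃ γ e, b < e ∧ M.IsLipPath γ a e ∧ γ a = γ₁ a ∧ γ e = γ₂ d ∧
      M.gLength γ a e = M.gLength γ₁ a b + M.gLength γ₂ c d := by
  set γ₃ : ℝ → SpacetimePt n := fun t => γ₂ (1 * t + (c - b)) with hγ₃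
  have h₃ : M.IsLipPath γ₃ b (d - (c - b)) :=
    h₂.comp_affine one_pos (c - b) (by linarith) (by linarith)
  have hL : M.gLength γ₃ b (d - (c - b)) = M.gLength γ₂ c d := by
    have := gLength_comp_add (M := M) γ₂ c d (c - b)
    rwa [show c - (c - b) = b by ring] at this
  have h13 : γ₁ b = γ₃ b := by simp [hγ₃, h12]
  have hg := h₁.glue h₃ h13
  have hbe : b < d - (c - b) := by linarith
  refine ⟨C1Spacetime.glue γ₁ γ₃ b, d - (c - b), hbe, hg, glue_of_le _ _ hab.le, ?_, ?_⟩
  · rw [glue_of_ge h13 hbe.le]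
    simp [hγ₃]
  · rw [← hL, ← gLength_congr (M := M) hab.le (γ := C1Spacetime.glue γ₁ γ₃ b)
      (fun t ht => glue_of_le _ _ ht.2.le), ← gLength_congr (M := M) hbe.le
      (γ := C1Spacetime.glue γ₁ γ₃ b) (fun t ht => glue_of_ge h13 ht.1.le)]
    exact (intervalIntegral.integral_add_adjacent_intervals (hg.intervalIntegrable_length _ _)
      (hg.intervalIntegrable_length _ _)).symm

theorem gLength_nonneg (γ : ℝ → SpacetimePt n) {a b : ℝ} (hab : a ≤ b) : 0 ≤ M.gLength γ a b :=
  intervalIntegral.integral_nonneg hab fun _ _ => Real.sqrt_nonneg _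

theorem IsLipPath.causalLe {γ : ℝ → SpacetimePt n} {a b : ℝ} (h : M.IsLipPath γ a b)
    (hab : a ≤ b) : M.causalLe (γ a) (γ b) := by
  rcases hab.eq_or_lt with rfl | hab
  · exact Or.inl rfl
  · exact Or.inr ⟨γ, a, b, hab, h.isFdCausalPathOn hab, rfl, rfl⟩

theorem causalLe_iff {p q : SpacetimePt n} : M.causalLe p q ↔
    p = q ∨ ∃ γ a b, a < b ∧ M.IsLipPath γ a b ∧ γ a = p ∧ γ b = q := by
  refine or_congr Iff.rfl ⟨?_, ?_⟩
  · rintro ⟨γ, a, b, hab, h, ha, hb⟩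
    obtain ⟨γ', h', heq, -⟩ := h.exists_isLipPath hab
    exact ⟨γ', a, b, hab, h', (heq ⟨le_rfl, hab.le⟩).symm.trans ha,
      (heq ⟨hab.le, le_rfl⟩).symm.trans hb⟩
  · rintro ⟨γ, a, b, hab, h, ha, hb⟩
    exact ⟨γ, a, b, hab, h.isFdCausalPathOn hab, ha, hb⟩

theorem causalLe.trans {p q r : SpacetimePt n} (h₁ : M.causalLe p q) (h₂ : M.causalLe q r) :
    M.causalLe p r := by
  rw [causalLe_iff] at h₁ h₂
  rcases h₁ with rfl | ⟨γ₁, a, b, hab, hγ₁, rfl, rfl⟩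
  · exact causalLe_iff.2 h₂
  rcases h₂ with rfl | ⟨γ₂, c, d, hcd, hγ₂, h12, rfl⟩
  · exact hγ₁.causalLe hab.le
  obtain ⟨γ, e, hbe, hγ, ha, he, -⟩ := hγ₁.exists_trans hab hcd hγ₂ h12.symm
  rw [← ha, ← he]
  exact hγ.causalLe (hab.trans hbe).le

/-- Distinct causally related points are joined by a causal curve on the unit interval. -/
theorem causalLe.exists_unit_path {p q : SpacetimePt n} (h : M.causalLe p q) (hne : p ≠ q) :
    ∃ γ, M.IsLipPath γ 0 1 ∧ γ 0 = p ∧ γ 1 = q := by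
  rcases causalLe_iff.1 h with h | ⟨γ, a, b, hab, hγ, rfl, rfl⟩
  · exact absurd h hne
  · exact ⟨_, hγ.comp_affine (sub_pos.2 hab) a (c := 0) (d := 1) (by simp) (by simp), by simp,
      by simp⟩

end C1Spacetime

theorem bilForm_sub_left {n : ℕ} (A : Fin n → Fin n → ℝ) (u u' v : Fin n → ℝ) :
    bilForm A (u - u') v = bilForm A u v - bilForm A u' v := by
  rw [eq_sub_iff_add_eq, ← bilForm_add_left, sub_add_cancel]

theorem intervalIntegral_mono_ae_Ioo {f h : ℝ → ℝ} {a b : ℝ} (hab : a ≤ b)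
    (hf : IntervalIntegrable f volume a b) (hh : IntervalIntegrable h volume a b)
    (hle : ∀ᵐ t, t ∈ Ioo a b → f t ≤ h t) : ∫ t in a..b, f t ≤ ∫ t in a..b, h t := by
  refine intervalIntegral.integral_mono_ae_restrict hab hf hh ?_
  rw [← restrict_Ioo_eq_restrict_Icc]
  exact (ae_restrict_iff' measurableSet_Ioo).2 hle

theorem HasDerivAt.bilForm_left {n : ℕ} (A : Fin n → Fin n → ℝ) {γ : ℝ → Fin n → ℝ}
    {γ' : Fin n → ℝ} {t : ℝ} (h : HasDerivAt γ γ' t) (v : Fin n → ℝ) :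
    HasDerivAt (fun s => bilForm A (γ s) v) (bilForm A γ' v) t := by
  unfold bilForm
  refine HasDerivAt.fun_sum fun i _ => HasDerivAt.fun_sum fun j _ => ?_
  exact ((hasDerivAt_pi.1 h i).const_mul (A i j)).mul_const (v j)

namespace C1Spacetime

variable {n : ℕ} {M : C1Spacetime n}

theorem exists_eventually_causalLe (M : C1Spacetime n) (w : SpacetimePt n) :
    ∃ e > 0, ∀ ε ∈ Ioo (0 : ℝ) e, ∀ᶠ u in 𝓝 w, M.causalLe u (w + ε • M.X0 w) := by
  have hopen : IsOpen {z : SpacetimePt n × SpacetimePt n |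
      bilForm (M.g z.1) z.2 z.2 < 0 ∧ bilForm (M.g z.1) z.2 (M.X0 z.1) < 0} :=
    (isOpen_lt (continuous_bilForm (M.continuous_g.comp continuous_fst) continuous_snd
      continuous_snd) continuous_const).inter
      (isOpen_lt (M.continuous_pairing M.X0_cont) continuous_const)
  obtain ⟨r, hr, hball⟩ := Metric.isOpen_iff.1 hopen (w, M.X0 w)
    ⟨M.X0_timelike w, M.X0_timelike w⟩
  set v := M.X0 w with hv
  have hv1 : 0 < ‖v‖ + 1 := by positivity
  refine ⟨r / (2 * (‖v‖ + 1)), by positivity, fun ε hε => ?_⟩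
  have hεv : ε * ‖v‖ < r / 2 := by
    have := (lt_div_iff₀ (by positivity)).1 hε.2
    nlinarith [hε.1, norm_nonneg v]
  filter_upwards [Metric.ball_mem_nhds w (show 0 < min (r / 2) (ε * r) from
    lt_min (by linarith) (mul_pos hε.1 hr))] with u hu
  rw [Metric.mem_ball, lt_min_iff, dist_eq_norm] at hu
  set d : SpacetimePt n := w + ε • v - u with hd
  set v' : SpacetimePt n := v + ε⁻¹ • (w - u) with hv'
  have hdv : d = ε • v' := by
    rw [hd, hv', smul_add, smul_smul, mul_inv_cancel₀ hε.1.ne', one_smul]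
    abel
  have hv'r : ‖v' - v‖ < r := by
    rw [hv', add_sub_cancel_left, norm_smul, norm_inv, Real.norm_of_nonneg hε.1.le, norm_sub_rev,
      inv_mul_lt_iff₀ hε.1]
    exact hu.2
  have hderiv : ∀ t : ℝ, HasDerivAt (fun t : ℝ => u + t • d) d t := fun t => by
    simpa using ((hasDerivAt_id t).smul_const d).const_add u
  have hpath : M.IsLipPath (fun t => u + t • d) 0 1 := by
    refine ⟨⟨‖d‖₊, LipschitzWith.of_dist_le_mul fun s t => ?_⟩, .of_forall fun t ht => ?_⟩
    · rw [dist_add_left, dist_eq_norm, ← sub_smul, norm_smul, dist_eq_norm, mul_comm]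
      rfl
    · have hy : ‖u + t • d - w‖ < r := by
        have : u + t • d - w = (1 - t) • (u - w) + t • (ε • v) := by
          rw [hd]
          module
        rw [this]
        calc ‖(1 - t) • (u - w) + t • (ε • v)‖ ≤ (1 - t) * ‖u - w‖ + t * (ε * ‖v‖) := by
              refine (norm_add_le _ _).trans (le_of_eq ?_)
              rw [norm_smul, norm_smul, norm_smul, Real.norm_of_nonneg (by linarith [ht.2]),
                Real.norm_of_nonneg ht.1.le, Real.norm_of_nonneg hε.1.le]
          _ < r := by nlinarith [ht.1, ht.2, hu.1, norm_nonneg (u - w)]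
      have hmem : (u + t • d, v') ∈ Metric.ball (w, v) r := by
        rw [Metric.mem_ball, Prod.dist_eq, max_lt_iff, dist_eq_norm, dist_eq_norm]
        exact ⟨hy, hv'r⟩
      obtain ⟨h1, h2⟩ := hball hmem
      have hc : M.CausalVec (u + t • d) v' := ⟨fun h0 => by simp [h0, bilForm] at h1, le_of_lt h1⟩
      rw [(hderiv t).deriv]
      refine ⟨(hderiv t).differentiableAt, ?_, ?_⟩
      · rw [hdv]
        exact CausalVec.smul (hdv ▸ hc) hε.1
      · rw [hdv]
        exact FdVec.smul (hdv ▸ h2) hε.1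
  have := hpath.causalLe zero_le_one
  simpa [hd] using this

/-- In a globally hyperbolic spacetime the causal relation is closed (under a common lower
bound). -/
theorem GloballyHyperbolic.causalLe_of_tendsto (hGH : M.GloballyHyperbolic)
    {p z w : SpacetimePt n} {zs ws : ℕ → SpacetimePt n} (hz : Tendsto zs atTop (𝓝 z))
    (hw : Tendsto ws atTop (𝓝 w)) (hp : ∀ j, M.causalLe p (zs j))
    (hzw : ∀ j, M.causalLe (zs j) (ws j)) : M.causalLe p z ∧ M.causalLe z w := by
  obtain ⟨e, he, hev⟩ := M.exists_eventually_causalLe w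
  have h1 : ∀ ε ∈ Ioo (0 : ℝ) e, M.causalLe p z ∧ M.causalLe z (w + ε • M.X0 w) := fun ε hε =>
    (hGH.2 p (w + ε • M.X0 w)).isClosed.mem_of_tendsto hz <| by
      filter_upwards [hw.eventually (hev ε hε)] with j hj
      exact ⟨hp j, (hzw j).trans hj⟩
  have hhalf : e / 2 ∈ Ioo (0 : ℝ) e := ⟨by linarith, by linarith⟩
  refine ⟨(h1 _ hhalf).1, ?_⟩
  have hlim : Tendsto (fun ε : ℝ => w + ε • M.X0 w) (𝓝[>] 0) (𝓝 w) := by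
    have : Continuous fun ε : ℝ => w + ε • M.X0 w := by fun_prop
    simpa using (this.tendsto 0).mono_left nhdsWithin_le_nhds
  refine ((hGH.2 z (w + (e / 2) • M.X0 w)).isClosed.mem_of_tendsto hlim ?_).1
  filter_upwards [Ioo_mem_nhdsGT he, hlim.eventually (hev _ hhalf)] with ε hε hε'
  exact ⟨(h1 ε hε).2, hε'⟩

/-- Causal curves contained in small balls have uniformly bounded coordinate arclength. -/
theorem exists_local_arcLen_bound (M : C1Spacetime n) (R : ℝ) :
    ∃ δ > 0, ∃ C : ℝ, ∀ w ∈ Metric.closedBall (0 : SpacetimePt n) R, ∀ γ a b, a ≤ b →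
      M.IsLipPath γ a b → (∀ t ∈ Icc a b, γ t ∈ Metric.closedBall w δ) → arcLen γ a b ≤ C := by
  obtain ⟨W, hW, hWn⟩ := M.exists_contDiff_timeField
  obtain ⟨c, hc, hcb⟩ := M.exists_pairing_lower_bound hW.continuous hWn (R + 1)
  set A : SpacetimePt n → Fin n → Fin n → ℝ := fun y i j => M.g y i j * W y j with hA
  have hAcont : Continuous A := by
    have h1 := M.continuous_g
    have h2 := hW.continuous
    refine continuous_pi fun i => continuous_pi fun j => ?_
    exact ((continuous_apply j).comp ((continuous_apply i).comp h1)).mul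
      ((continuous_apply j).comp h2)
  have hAW : ∀ y v, bilForm (M.g y) v (W y) = bilForm (A y) v 1 := fun y v => by
    simp only [bilForm, hA, Pi.one_apply]
    exact Finset.sum_congr rfl fun i _ => Finset.sum_congr rfl fun j _ => by ring
  have hone : ‖(1 : SpacetimePt n)‖ ≤ 1 :=
    (pi_norm_le_iff_of_nonneg zero_le_one).2 fun i => by simp
  have hK : IsCompact (Metric.closedBall (0 : SpacetimePt n) (R + 1)) := isCompact_closedBall _ _
  obtain ⟨B, hB⟩ := hK.exists_bound_of_continuousOn hAcont.continuousOn
  have huc := hK.uniformContinuousOn_of_continuous hAcont.continuousOn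
  obtain ⟨δ₀, hδ₀, hδ⟩ := Metric.uniformContinuousOn_iff_le.1 huc (c / (2 * ((n : ℝ) ^ 2 + 1)))
    (by positivity)
  refine ⟨min δ₀ 1, lt_min hδ₀ one_pos, 2 / c * ((n : ℝ) ^ 2 * B * 2),
    fun w hw γ a b hab hγ hball => ?_⟩
  have hwK : w ∈ Metric.closedBall (0 : SpacetimePt n) (R + 1) :=
    Metric.closedBall_subset_closedBall (by linarith) hw
  set ψ : ℝ → ℝ := fun t => bilForm (A w) (γ t) 1 with hψ
  obtain ⟨⟨K, hKγ⟩, hae⟩ := id hγ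
  have hB0 : 0 ≤ B := (norm_nonneg _).trans (hB w hwK)
  have hbd : ∀ v : SpacetimePt n, |bilForm (A w) v 1| ≤ (n : ℝ) ^ 2 * B * ‖v‖ := fun v => by
    refine (abs_bilForm_le _ _ _).trans ?_
    calc (n : ℝ) ^ 2 * ‖A w‖ * ‖v‖ * ‖(1 : SpacetimePt n)‖
        ≤ (n : ℝ) ^ 2 * B * ‖v‖ * 1 := by
          have := hB w hwK
          gcongr
      _ = _ := by ring
  have hψlip : LipschitzWith (Real.toNNReal ((n : ℝ) ^ 2 * B) * K) ψ :=
    LipschitzWith.of_dist_le_mul fun s t => by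
      rw [Real.dist_eq, hψ]
      simp only
      rw [← bilForm_sub_left]
      refine (hbd _).trans ?_
      rw [NNReal.coe_mul, Real.coe_toNNReal _ (by positivity),
        mul_assoc ((n : ℝ) ^ 2 * B)]
      have := hKγ.dist_le_mul s t
      rw [dist_eq_norm] at this
      gcongr
  have hftc : ∫ t in a..b, deriv ψ t = ψ b - ψ a :=
    (hψlip.lipschitzOnWith.absolutelyContinuousOnInterval).integral_deriv_eq_sub
  have hint : IntervalIntegrable (deriv ψ) volume a b :=
    intervalIntegrable_of_measurable_bounded (measurable_deriv ψ)
      fun t _ => norm_deriv_le_of_lipschitz hψlip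
  have hle : arcLen γ a b ≤ ∫ t in a..b, (2 / c) * (- deriv ψ t) := by
    refine intervalIntegral_mono_ae_Ioo hab (hγ.intervalIntegrable_norm_deriv _ _)
      (hint.neg.const_mul _) ?_
    filter_upwards [hae] with t ht htm
    obtain ⟨hd, hcv, hfv⟩ := ht htm
    have hwt := hball t ⟨htm.1.le, htm.2.le⟩
    rw [Metric.mem_closedBall] at hwt
    have htK : γ t ∈ Metric.closedBall (0 : SpacetimePt n) (R + 1) := by
      rw [Metric.mem_closedBall] at hw ⊢
      linarith [dist_triangle (γ t) w 0, hwt.trans (min_le_right _ _)]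
    have h1 := hcb _ htK _ hcv hfv
    have h2 := hδ _ htK _ hwK (hwt.trans (min_le_left _ _))
    rw [dist_eq_norm] at h2
    have h3 : |bilForm (A (γ t) - A w) (deriv γ t) 1| ≤ c / 2 * ‖deriv γ t‖ := by
      refine (abs_bilForm_le _ _ _).trans ?_
      calc (n : ℝ) ^ 2 * ‖A (γ t) - A w‖ * ‖deriv γ t‖ * ‖(1 : SpacetimePt n)‖
          ≤ ((n : ℝ) ^ 2 + 1) * (c / (2 * ((n : ℝ) ^ 2 + 1))) * ‖deriv γ t‖ * 1 := by
            gcongr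
            linarith
        _ = _ := by field_simp
    rw [bilForm_sub_coeff, ← hAW] at h3
    rw [(HasDerivAt.bilForm_left (A w) hd.hasDerivAt 1).deriv, div_mul_eq_mul_div, le_div_iff₀ hc]
    linarith [(abs_le.1 h3).1]
  rw [intervalIntegral.integral_const_mul, intervalIntegral.integral_neg, hftc] at hle
  refine hle.trans ?_
  gcongr
  have h4 := hbd (γ a - γ b)
  rw [bilForm_sub_left] at h4
  have h5 : ‖γ a - γ b‖ ≤ 2 := by
    have ha := (hball a (left_mem_Icc.2 hab))
    have hb := (hball b (right_mem_Icc.2 hab))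
    rw [Metric.mem_closedBall] at ha hb
    rw [← dist_eq_norm]
    linarith [dist_triangle_right (γ a) (γ b) w, min_le_right δ₀ 1]
  calc -(ψ b - ψ a) = ψ a - ψ b := by ring
    _ ≤ _ := (le_abs_self _).trans h4
    _ ≤ _ := by gcongr

end C1Spacetime

namespace C1Spacetime

variable {n : ℕ} {M : C1Spacetime n}

/-- Causal curves from `p` to points arbitrarily close to `w` can be arbitrarily long in
coordinate arclength. -/
def LongApprox (M : C1Spacetime n) (p w : SpacetimePt n) : Prop :=
  ∀ ε > 0, ∀ N : ℝ, ∃ γ a b, a < b ∧ M.IsLipPath γ a b ∧ γ a = p ∧ ‖γ b - w‖ < ε ∧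
    N ≤ arcLen γ a b

theorem IsLipPath.exists_exit_time {γ : ℝ → SpacetimePt n} {a b : ℝ} (hab : a < b)
    (h : M.IsLipPath γ a b) {w : SpacetimePt n} {δ C N : ℝ} (hN : 0 < N)
    (hC : ∀ γ a b, a ≤ b → M.IsLipPath γ a b → (∀ t ∈ Icc a b, γ t ∈ Metric.closedBall w δ) →
      arcLen γ a b ≤ C) (hb : ‖γ b - w‖ < δ) (hlen : C + N ≤ arcLen γ a b) :
    ∃ t, a < t ∧ t ≤ b ∧ ‖γ t - w‖ = δ ∧ N ≤ arcLen γ a t := by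
  have hcont : Continuous fun t => ‖γ t - w‖ := (h.continuous.sub continuous_const).norm
  have hScomp : IsCompact (Icc a b ∩ {t | δ ≤ ‖γ t - w‖}) :=
    isCompact_Icc.inter_right (isClosed_le continuous_const hcont)
  have hSne : (Icc a b ∩ {t | δ ≤ ‖γ t - w‖}).Nonempty := by
    by_contra hne
    rw [not_nonempty_iff_eq_empty] at hne
    have := hC γ a b hab.le h fun t ht => by
      rw [Metric.mem_closedBall, dist_eq_norm]
      by_contra hlt
      exact (Set.ext_iff.1 hne t).1 ⟨ht, (not_le.1 hlt).le⟩
    linarith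
  obtain ⟨t, ⟨htm, htδ⟩, htmax⟩ := hScomp.exists_isGreatest hSne
  have htb : t < b := lt_of_le_of_ne htm.2 fun he => by
    rw [he] at htδ
    exact absurd htδ (not_le.2 hb)
  have hlt : ∀ s ∈ Ioc t b, ‖γ s - w‖ ≤ δ := fun s hs => by
    by_contra hlt
    exact absurd (htmax ⟨⟨htm.1.trans hs.1.le, hs.2⟩, (not_le.1 hlt).le⟩) (not_le.2 hs.1)
  have hle : ∀ s ∈ Icc t b, ‖γ s - w‖ ≤ δ := by
    have hcl : IsClosed {s | ‖γ s - w‖ ≤ δ} := isClosed_le hcont continuous_const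
    have := hcl.closure_subset_iff.2 (show Ioc t b ⊆ {s | ‖γ s - w‖ ≤ δ} from hlt)
    rw [closure_Ioc htb.ne] at this
    exact this
  have h2 := hC γ t b htb.le (h.mono htm.1 le_rfl) fun s hs => by
    rw [Metric.mem_closedBall, dist_eq_norm]
    exact hle s hs
  have hsplit : arcLen γ a t + arcLen γ t b = arcLen γ a b :=
    intervalIntegral.integral_add_adjacent_intervals (h.intervalIntegrable_norm_deriv _ _)
      (h.intervalIntegrable_norm_deriv _ _)
  have hlen' : N ≤ arcLen γ a t := by linarith
  refine ⟨t, lt_of_le_of_ne htm.1 fun he => ?_, htm.2,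
    le_antisymm (hle t ⟨le_rfl, htb.le⟩) htδ, hlen'⟩
  rw [← he, arcLen, intervalIntegral.integral_same] at hlen'
  linarith

theorem LongApprox.exists_step (hGH : M.GloballyHyperbolic) {p w : SpacetimePt n} {δ C : ℝ}
    (hδ : 0 < δ)
    (hC : ∀ γ a b, a ≤ b → M.IsLipPath γ a b → (∀ t ∈ Icc a b, γ t ∈ Metric.closedBall w δ) →
      arcLen γ a b ≤ C) (hw : M.LongApprox p w) :
    ∃ z, M.LongApprox p z ∧ M.causalLe p z ∧ M.causalLe z w ∧ δ ≤ dist z w := by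
  have hex : ∀ j : ℕ, ∃ (γ : ℝ → SpacetimePt n) (a t b : ℝ), a < t ∧ t ≤ b ∧ M.IsLipPath γ a b ∧
      γ a = p ∧ ‖γ b - w‖ < 1 / ((j : ℝ) + 1) ∧ γ t ∈ Metric.sphere w δ ∧
      (j : ℝ) ≤ arcLen γ a t := fun j => by
    obtain ⟨γ, a, b, hab, h, hp, hb, hlen⟩ := hw (min δ (1 / ((j : ℝ) + 1)))
      (lt_min hδ (by positivity)) (C + ((j : ℝ) + 1))
    obtain ⟨t, h1, h2, h3, h4⟩ := h.exists_exit_time hab (by positivity) hC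
      (hb.trans_le (min_le_left _ _)) hlen
    exact ⟨γ, a, t, b, h1, h2, h, hp, hb.trans_le (min_le_right _ _), by simpa [dist_eq_norm] using h3,
      by linarith⟩
  choose γ a t b hat htb hγ hp hb hsph hlen using hex
  obtain ⟨z, hz, φ, hφ, hlim⟩ := (isCompact_sphere w δ).tendsto_subseq hsph
  have hblim : Tendsto (fun j => γ j (b j)) atTop (𝓝 w) :=
    tendsto_iff_norm_sub_tendsto_zero.2 (squeeze_zero (fun _ => norm_nonneg _)
      (fun j => (hb j).le) tendsto_one_div_add_atTop_nhds_zero_nat)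
  obtain ⟨h1, h2⟩ := hGH.causalLe_of_tendsto hlim (hblim.comp hφ.tendsto_atTop)
    (fun j => hp (φ j) ▸ ((hγ (φ j)).mono le_rfl (htb _)).causalLe (hat _).le)
    (fun j => ((hγ (φ j)).mono (hat _).le le_rfl).causalLe (htb _))
  refine ⟨z, fun ε hε N => ?_, h1, h2, (Metric.mem_sphere.1 hz).ge⟩
  have hN : ∀ᶠ j in atTop, N ≤ (φ j : ℝ) :=
    (tendsto_natCast_atTop_atTop.comp hφ.tendsto_atTop).eventually_ge_atTop N
  obtain ⟨j, hj, hjN⟩ := ((Metric.tendsto_nhds.1 hlim ε hε).and hN).exists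
  exact ⟨γ (φ j), a (φ j), t (φ j), hat _, (hγ _).mono le_rfl (htb _), hp _,
    by rwa [← dist_eq_norm], hjN.trans (hlen _)⟩

/-- An infinite past-directed causal chain in a compact set with steps bounded below contradicts
non-imprisonment. -/
theorem NonImprisoning.false_of_chain (hNI : M.NonImprisoning) {K : Set (SpacetimePt n)}
    (hK : IsCompact K) {w : ℕ → SpacetimePt n} {δ : ℝ} (hδ : 0 < δ)
    (hle : ∀ N, M.causalLe (w (N + 1)) (w N)) (hdist : ∀ N, δ ≤ dist (w (N + 1)) (w N))
    (hmem : ∀ N u, M.causalLe (w N) u → M.causalLe u (w 0) → u ∈ K) : False := by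
  have hne : ∀ N, w (N + 1) ≠ w N := fun N h => by
    have := hdist N
    rw [h, dist_self] at this
    linarith
  choose c hc hc0 hc1 using fun N => (hle N).exists_unit_path (hne N)
  let G : ℕ → ℝ → SpacetimePt n := fun N => Nat.rec (fun _ => w 0)
    (fun N GN => glue (fun t => c N (1 * t + ((N : ℝ) + 1))) GN (-(N : ℝ))) N
  have hGs : ∀ N, G (N + 1) = glue (fun t => c N (1 * t + ((N : ℝ) + 1))) (G N) (-(N : ℝ)) :=
    fun N => rfl
  have hGprop : ∀ N : ℕ, M.IsLipPath (G N) (-(N : ℝ)) 0 ∧ G N (-(N : ℝ)) = w N := fun N => by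
    induction N with
    | zero =>
      refine ⟨⟨⟨0, LipschitzWith.const _⟩, .of_forall fun t ht => ?_⟩, rfl⟩
      simp only [Nat.cast_zero, neg_zero] at ht
      exact absurd (ht.1.trans ht.2) (lt_irrefl _)
    | succ N ih =>
      rw [hGs]
      refine ⟨?_, ?_⟩
      · refine IsLipPath.glue ((hc N).comp_affine one_pos _ ?_ ?_) ih.1 ?_
        · push_cast; linarith
        · linarith
        · rw [ih.2, ← hc1]
          congr 1
          ring
      · rw [glue_of_le _ _ (by push_cast; linarith), ← hc0]
        congr 1
        push_cast
        ring
  have hGeq1 : ∀ (N : ℕ) (t : ℝ), -(N : ℝ) ≤ t → G (N + 1) t = G N t := fun N t ht => by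
    rw [hGs]
    refine glue_of_ge ?_ ht
    rw [(hGprop N).2, ← hc1]
    congr 1
    ring
  have hGeq : ∀ (N m : ℕ) (t : ℝ), N ≤ m → -(N : ℝ) ≤ t → G m t = G N t := fun N m t hNm ht => by
    induction m, hNm using Nat.le_induction with
    | base => rfl
    | succ m hm ih =>
      rw [hGeq1 m t (by have : (N : ℝ) ≤ m := by exact_mod_cast hm
                        linarith), ih]
  set Γ : ℝ → SpacetimePt n := fun t => G ⌈-t⌉₊ t with hΓ
  have hΓeq : ∀ (N : ℕ) (t : ℝ), -(N : ℝ) ≤ t → Γ t = G N t := fun N t ht =>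
    (hGeq _ _ t (Nat.ceil_le.2 (by linarith)) (by linarith [Nat.le_ceil (-t)])).symm
  have hΓev : ∀ (N : ℕ) (t : ℝ), -(N : ℝ) < t → Γ =ᶠ[𝓝 t] G N := fun N t ht =>
    Filter.eventuallyEq_of_mem (Ioi_mem_nhds ht) fun s hs => hΓeq N s (le_of_lt hs)
  have hlt : ∀ t : ℝ, ∃ N : ℕ, -(N : ℝ) < t := fun t => by
    obtain ⟨N, hN⟩ := exists_nat_gt (-t)
    exact ⟨N, by linarith⟩
  have hpath : M.IsFdCausalPathOn Γ (Iic 0) := by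
    refine ⟨ordConnected_Iic, nonempty_Iic, fun t _ => ?_, ?_⟩
    · obtain ⟨N, hN⟩ := hlt t
      obtain ⟨L, hL⟩ := (hGprop N).1.1
      refine ⟨L, Ioi (-(N : ℝ)), mem_nhdsWithin_of_mem_nhds (Ioi_mem_nhds hN), ?_⟩
      intro s hs u hu
      rw [hΓeq N s (le_of_lt hs), hΓeq N u (le_of_lt hu)]
      exact hL s u
    · rw [← restrict_Iio_eq_restrict_Iic]
      refine (ae_restrict_iff' measurableSet_Iio).2 ?_
      filter_upwards [ae_all_iff.2 fun N => (hGprop N).1.2] with t ht ht0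
      obtain ⟨N, hN⟩ := hlt t
      obtain ⟨h1, h2⟩ := ht N ⟨hN, ht0⟩
      rw [(hΓev N t hN).deriv_eq, (hΓev N t hN).eq_of_nhds]
      exact ⟨h1.congr_of_eventuallyEq (hΓev N t hN), h2⟩
  refine (hNI K hK).2.2.2 0 Γ hpath ?_ fun t ht => ?_
  · rintro ⟨q, hq⟩
    have hneg : Tendsto (fun N : ℕ => -(N : ℝ)) atTop atBot :=
      tendsto_neg_atTop_atBot.comp tendsto_natCast_atTop_atTop
    have hwq : Tendsto w atTop (𝓝 q) := by
      refine (hq.comp hneg).congr fun N => ?_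
      rw [Function.comp_apply, hΓeq N _ le_rfl, (hGprop N).2]
    have := ((hwq.comp (tendsto_add_atTop_nat 1)).dist hwq)
    rw [dist_self] at this
    exact absurd (ge_of_tendsto' this hdist) (not_le.2 hδ)
  · obtain ⟨N, hN⟩ := hlt t
    have h1 := ((hGprop N).1.mono le_rfl ht).causalLe hN.le
    have h2 := ((hGprop N).1.mono hN.le le_rfl).causalLe ht
    rw [(hGprop N).2] at h1
    rw [← hΓeq N 0 (by linarith [show t ≤ 0 from ht]), hΓeq 0 0 (by simp)] at h2
    rw [hΓeq N t hN.le]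
    exact hmem N _ h1 h2

/-- In a globally hyperbolic spacetime, causal curves between two given points have uniformly
bounded coordinate arclength. -/
theorem GloballyHyperbolic.exists_arcLen_bound (hGH : M.GloballyHyperbolic)
    (p y : SpacetimePt n) : ∃ A > 0, ∀ γ a b, a < b → M.IsLipPath γ a b → γ a = p → γ b = y →
      arcLen γ a b ≤ A := by
  by_contra! hcon
  have hy : M.LongApprox p y := fun ε hε N => by
    obtain ⟨γ, a, b, hab, h, hp, hb, hlen⟩ := hcon (max N 1) (by positivity)
    exact ⟨γ, a, b, hab, h, hp, by simpa [hb] using hε, (le_max_left _ _).trans hlen.le⟩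
  have hpy : M.causalLe p y := by
    obtain ⟨γ, a, b, hab, h, rfl, rfl, -⟩ := hcon 1 one_pos
    exact h.causalLe hab.le
  obtain ⟨R, hR⟩ := (hGH.2 p y).isBounded.subset_closedBall 0
  obtain ⟨δ, hδ, C, hC⟩ := M.exists_local_arcLen_bound R
  have hstep : ∀ w : {w // M.LongApprox p w ∧ M.causalLe p w ∧ M.causalLe w y},
      ∃ z : {w // M.LongApprox p w ∧ M.causalLe p w ∧ M.causalLe w y},
        M.causalLe z w ∧ δ ≤ dist z.1 w.1 := fun w => by
    obtain ⟨z, h1, h2, h3, h4⟩ := w.2.1.exists_step hGH hδ (hC w.1 (hR w.2.2))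
    exact ⟨⟨z, h1, h2, h3.trans w.2.2.2⟩, h3, h4⟩
  choose f hf1 hf2 using hstep
  let w : ℕ → {w // M.LongApprox p w ∧ M.causalLe p w ∧ M.causalLe w y} := fun N =>
    f^[N] ⟨y, hy, hpy, Or.inl rfl⟩
  have hws : ∀ N, w (N + 1) = f (w N) := fun N => Function.iterate_succ_apply' f N _
  refine hGH.1.false_of_chain (hGH.2 p y) (w := fun N => (w N).1) hδ (fun N => ?_) (fun N => ?_)
    fun N u h1 h2 => ⟨(w N).2.2.1.trans h1, h2⟩
  · rw [hws]
    exact hf1 _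
  · rw [hws]
    exact hf2 _

end C1Spacetime

theorem eventually_mul_lt_of_pos (X : ℝ) {Y : ℝ} (hY : 0 < Y) : ∀ᶠ h : ℝ in 𝓝[>] 0, h * X < Y := by
  have : Tendsto (fun h : ℝ => h * X) (𝓝[>] 0) (𝓝 (0 * X)) :=
    ((continuous_id.mul continuous_const).tendsto 0).mono_left nhdsWithin_le_nhds
  rw [zero_mul] at this
  exact this.eventually (gt_mem_nhds hY)

namespace C1Spacetime

variable {n : ℕ} (M : C1Spacetime n)

theorem exists_metric_bound (R : ℝ) : ∃ G ≥ 0, ∀ y ∈ Metric.closedBall (0 : SpacetimePt n) R,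
    ∀ u v, |bilForm (M.g y) u v| ≤ G * ‖u‖ * ‖v‖ := by
  obtain ⟨B, hB⟩ := (isCompact_closedBall (0 : SpacetimePt n) R).exists_bound_of_continuousOn
    M.continuous_g.continuousOn
  refine ⟨(n : ℝ) ^ 2 * |B|, by positivity, fun y hy u v => (abs_bilForm_le _ _ _).trans ?_⟩
  have := (hB y hy).trans (le_abs_self B)
  gcongr

theorem exists_metric_lipschitz (R : ℝ) : ∃ l ≥ 0, ∀ y ∈ Metric.closedBall (0 : SpacetimePt n) R,
    ∀ y' ∈ Metric.closedBall (0 : SpacetimePt n) R, ∀ u v,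
      |bilForm (M.g y') u v - bilForm (M.g y) u v| ≤ l * ‖y' - y‖ * ‖u‖ * ‖v‖ := by
  obtain ⟨L, hL⟩ := (M.g_contDiff.locallyLipschitz.locallyLipschitzOn
    (s := Metric.closedBall (0 : SpacetimePt n) R)).exists_lipschitzOnWith_of_compact
      (isCompact_closedBall _ _)
  refine ⟨(n : ℝ) ^ 2 * L, by positivity, fun y hy y' hy' u v => ?_⟩
  rw [← bilForm_sub_coeff]
  refine (abs_bilForm_le _ _ _).trans ?_
  have := hL.dist_le_mul y' hy' y hy
  rw [dist_eq_norm, dist_eq_norm] at this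
  rw [mul_assoc ((n : ℝ) ^ 2) (L : ℝ)]
  gcongr

/-- Pushing a unit causal vector against a time field. -/
theorem exists_push_unit {W : SpacetimePt n → SpacetimePt n} (hW : ContDiff ℝ 1 W)
    (hWn : ∀ y v, M.CausalVec y v → M.FdVec y v → bilForm (M.g y) v (W y) < 0) (R : ℝ) :
    ∃ K > 0, ∃ c > 0, ∀ F ≥ 0, ∀ A ≥ 0, ∃ C ≥ 0, ∀ᶠ h in 𝓝[>] (0 : ℝ),
      ∀ y ∈ Metric.closedBall (0 : SpacetimePt n) R, ∀ u, ‖u‖ = 1 → M.CausalVec y u → M.FdVec y u →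
      ∀ f ∈ Icc 0 F, ∀ a ∈ Icc 0 A, ∀ b ∈ Icc (0 : ℝ) 1,
        M.FdVec (y - (h * f) • W y) (u - h • ((-K * f + a * (-bilForm (M.g y) u u) - b) • W y +
            f • fderiv ℝ W y u)) ∧
        (-bilForm (M.g y) u u) * (1 - h * C) + h * c * b ≤
          -bilForm (M.g (y - (h * f) • W y))
            (u - h • ((-K * f + a * (-bilForm (M.g y) u u) - b) • W y + f • fderiv ℝ W y u))
            (u - h • ((-K * f + a * (-bilForm (M.g y) u u) - b) • W y + f • fderiv ℝ W y u)) := by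
  obtain ⟨c, hc, hcb⟩ := M.exists_pairing_lower_bound hW.continuous hWn R
  obtain ⟨ρ, hρ, hρb⟩ := M.exists_fd_radius R
  obtain ⟨G, hG0, hG⟩ := M.exists_metric_bound (R + 1)
  obtain ⟨l, hl0, hl⟩ := M.exists_metric_lipschitz (R + 1)
  obtain ⟨w, hw⟩ := (isCompact_closedBall (0 : SpacetimePt n) R).exists_bound_of_continuousOn
    hW.continuous.continuousOn
  obtain ⟨d, hd⟩ := (isCompact_closedBall (0 : SpacetimePt n) R).exists_bound_of_continuousOn
    (hW.continuous_fderiv one_ne_zero).continuousOn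
  by_cases hR : 0 ≤ R
  swap
  · refine ⟨1, one_pos, 1, one_pos, fun F _ A _ => ⟨0, le_rfl, .of_forall fun h y hy => ?_⟩⟩
    rw [Metric.closedBall_eq_empty.2 (not_le.1 hR)] at hy
    exact absurd hy (notMem_empty _)
  have hw0 : 0 ≤ w := (norm_nonneg _).trans (hw 0 (by simpa using hR))
  have hd0 : 0 ≤ d := (norm_nonneg _).trans (hd 0 (by simpa using hR))
  set K := (2 * G * d + 4 * l * w + c * d) / c + 1 with hK
  have hK0 : 0 < K := by positivity
  have hKc : 2 * G * d + 4 * l * w + c * d ≤ K * c := by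
    rw [hK, add_mul, div_mul_cancel₀ _ hc.ne']
    linarith
  refine ⟨K, hK0, c, hc, fun F hF A hA => ⟨A * (2 * G * w + c), by positivity, ?_⟩⟩
  set E := w * (K * F + A * G + 1) + F * d with hE
  have hE0 : 0 ≤ E := by positivity
  filter_upwards [self_mem_nhdsWithin, eventually_mul_lt_of_pos E one_pos,
    eventually_mul_lt_of_pos (G * E) (show 0 < c / (w + 1) by positivity),
    eventually_mul_lt_of_pos (F * w) hρ, eventually_mul_lt_of_pos (F * w) one_pos,
    eventually_mul_lt_of_pos E hρ] with h hh hhE hhG hhρ hhF hhρ' y hy u hu hcu hfu f hf a ha b hb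
  have hh : 0 < h := hh
  have hyR : y ∈ Metric.closedBall (0 : SpacetimePt n) (R + 1) :=
    Metric.closedBall_subset_closedBall (by linarith) hy
  have hWy := hw y hy
  have hDu : ‖fderiv ℝ W y u‖ ≤ d := by
    have := (fderiv ℝ W y).le_of_opNorm_le (hd y hy) u
    rwa [hu, mul_one] at this
  have hguu := hG y hyR u u
  have hguW := hG y hyR u (W y)
  have hguD := hG y hyR u (fderiv ℝ W y u)
  have hP1 := hcb y hy u hcu hfu
  rw [hu] at hguu hguW hguD hP1
  set D := fderiv ℝ W y u
  set q := -bilForm (M.g y) u u with hq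
  have hq0 : 0 ≤ q := neg_nonneg.2 hcu.2
  have hqG : q ≤ G := by linarith [(abs_le.1 hguu).1]
  set P := -bilForm (M.g y) u (W y) with hP
  have hPw : P ≤ G * w := by
    have : G * 1 * ‖W y‖ ≤ G * w := by rw [mul_one]; gcongr
    linarith [(abs_le.1 hguW).1]
  set φ := -K * f + a * q - b with hφ
  set ξ := φ • W y + f • D with hξ
  have hφ' : |φ| ≤ K * f + a * q + b := by
    rw [abs_le]
    have h1 : 0 ≤ K * f := mul_nonneg hK0.le hf.1
    have h2 : 0 ≤ a * q := mul_nonneg ha.1 hq0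
    constructor <;> rw [hφ] <;> linarith [hb.1]
  have hξn : ‖ξ‖ ≤ w * (K * f + a * q + b) + f * d := by
    refine (norm_add_le _ _).trans ?_
    rw [norm_smul, norm_smul, Real.norm_eq_abs, Real.norm_of_nonneg hf.1, mul_comm w]
    have := hf.1
    have := (abs_nonneg _).trans hφ'
    gcongr
  have hξE : ‖ξ‖ ≤ E := by
    refine hξn.trans ?_
    have h1 := hf.1
    have h2 := hf.2
    have h3 := ha.1
    have h4 := ha.2
    have h5 := hb.2
    rw [hE]
    gcongr
  have hy'y : ‖(y - (h * f) • W y) - y‖ ≤ h * f * w := by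
    rw [sub_sub_cancel_left, norm_neg, norm_smul, Real.norm_of_nonneg (mul_nonneg hh.le hf.1)]
    have := hf.1
    gcongr
  have hfF : h * f * w ≤ h * (F * w) := by
    rw [mul_assoc]
    have := hf.2
    gcongr
  have hu'u : ‖u - h • ξ - u‖ ≤ h * E := by
    rw [sub_sub_cancel_left, norm_neg, norm_smul, Real.norm_of_nonneg hh.le]
    gcongr
  have hy'R : y - (h * f) • W y ∈ Metric.closedBall (0 : SpacetimePt n) (R + 1) := by
    rw [mem_closedBall_zero_iff] at hy ⊢
    have := norm_add_le ((y - (h * f) • W y) - y) y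
    rw [sub_add_cancel] at this
    linarith
  refine ⟨hρb y hy u hu hcu hfu _ _ (by linarith) (by linarith), ?_⟩
  have hu'2 : ‖u - h • ξ‖ ≤ 2 := by
    have := norm_add_le (u - h • ξ - u) u
    rw [sub_add_cancel, hu] at this
    linarith
  have hlip := hl y hyR _ hy'R (u - h • ξ) (u - h • ξ)
  have hlip' : l * ‖(y - (h * f) • W y) - y‖ * ‖u - h • ξ‖ * ‖u - h • ξ‖ ≤
      l * (h * f * w) * 2 * 2 := by
    have := mul_nonneg (mul_nonneg hh.le hf.1) hw0
    gcongr
  have hexp : bilForm (M.g y) (u - h • ξ) (u - h • ξ) =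
      -q + 2 * h * (φ * P) - 2 * h * f * bilForm (M.g y) u D + h ^ 2 * bilForm (M.g y) ξ ξ := by
    have hξu : bilForm (M.g y) u ξ = -(φ * P) + f * bilForm (M.g y) u D := by
      rw [hξ, bilForm_add_right, bilForm_smul_right, bilForm_smul_right, hP]
      ring
    have : u - h • ξ = u + (-h) • ξ := by rw [neg_smul, sub_eq_add_neg]
    rw [this, bilForm_add_left, bilForm_add_right, bilForm_add_right, bilForm_smul_left,
      bilForm_smul_left, bilForm_smul_right, bilForm_smul_right, M.bilForm_comm y ξ u, hξu, hq]
    ring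
  have hφP : φ * P ≤ -K * f * c + a * q * (G * w) - b * c := by
    have h1 : K * f * c ≤ K * f * P := by
      have := hf.1
      gcongr
      linarith
    have h2 : a * q * P ≤ a * q * (G * w) := by
      have := ha.1
      gcongr
    have h3 : b * c ≤ b * P := by
      have := hb.1
      gcongr
      linarith
    rw [hφ]
    linarith
  have huD : -(f * bilForm (M.g y) u D) ≤ f * (G * d) := by
    have h1 : G * 1 * ‖D‖ ≤ G * d := by rw [mul_one]; gcongr
    have h2 := (abs_le.1 hguD).1
    have := hf.1
    rw [← mul_neg]
    gcongr
    linarith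
  have hξξ : h * bilForm (M.g y) ξ ξ ≤ c * (K * f + a * q + b + f * d) := by
    have h1 := (abs_le.1 (hG y hyR ξ ξ)).2
    have hB : 0 ≤ K * f + a * q + b + f * d := by
      have := hf.1
      have := ha.1
      have := hb.1
      positivity
    have h2 : ‖ξ‖ ≤ (w + 1) * (K * f + a * q + b + f * d) := by
      have h3 : 0 ≤ w * (f * d) := mul_nonneg hw0 (mul_nonneg hf.1 hd0)
      have h4 : 0 ≤ K * f + a * q + b := by
        have := hf.1
        have := ha.1
        have := hb.1
        positivity
      linarith
    calc h * bilForm (M.g y) ξ ξ ≤ h * (G * ‖ξ‖ * ‖ξ‖) := by gcongr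
      _ ≤ h * (G * E * ((w + 1) * (K * f + a * q + b + f * d))) := by gcongr
      _ = h * (G * E) * ((w + 1) * (K * f + a * q + b + f * d)) := by ring
      _ ≤ c / (w + 1) * ((w + 1) * (K * f + a * q + b + f * d)) := by gcongr
      _ = _ := by field_simp
  have hlin : 2 * (φ * P) - 2 * (f * bilForm (M.g y) u D) + h * bilForm (M.g y) ξ ξ
      + l * (f * w) * 4 ≤ A * (2 * G * w + c) * q - c * b := by
    have h1 : f * (2 * G * d + 4 * l * w + c * d) ≤ f * (K * c) := by
      have := hf.1
      gcongr
    have h2 : a * (2 * G * w + c) * q ≤ A * (2 * G * w + c) * q := by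
      have := ha.2
      gcongr
    linarith
  have hfin := mul_le_mul_of_nonneg_left hlin hh.le
  have := (abs_le.1 hlip).2
  linarith

end C1Spacetime

namespace C1Spacetime

variable {n : ℕ} (M : C1Spacetime n)

/-- Pushing a causal vector against a time field. -/
theorem exists_push {W : SpacetimePt n → SpacetimePt n} (hW : ContDiff ℝ 1 W)
    (hWn : ∀ y v, M.CausalVec y v → M.FdVec y v → bilForm (M.g y) v (W y) < 0) (R : ℝ) :
    ∃ K > 0, ∃ c > 0, ∀ F ≥ 0, ∀ A ≥ 0, ∃ C ≥ 0, ∀ᶠ h in 𝓝[>] (0 : ℝ),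
      ∀ y ∈ Metric.closedBall (0 : SpacetimePt n) R, ∀ v, M.CausalVec y v → M.FdVec y v →
      ∀ f ∈ Icc 0 F, ∀ a ∈ Icc 0 A, ∀ b ∈ Icc (0 : ℝ) 1, ∀ φ v',
        φ = -K * ‖v‖ * f + a * (-bilForm (M.g y) v v / ‖v‖) - b * ‖v‖ →
        v' = v - h • (φ • W y + f • fderiv ℝ W y v) →
        M.FdVec (y - (h * f) • W y) v' ∧
        (-bilForm (M.g y) v v) * (1 - h * C) + h * c * b * ‖v‖ ^ 2 ≤
          -bilForm (M.g (y - (h * f) • W y)) v' v' := by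
  obtain ⟨K, hK, c, hc, H⟩ := M.exists_push_unit hW hWn R
  refine ⟨K, hK, c, hc, fun F hF A hA => ?_⟩
  obtain ⟨C, hC, hev⟩ := H F hF A hA
  refine ⟨C, hC, hev.mono fun h hh y hy v hcv hfv f hf a ha b hb φ v' hφ hv' => ?_⟩
  have hσ : 0 < ‖v‖ := norm_pos_iff.2 hcv.1
  obtain ⟨h1, h2⟩ := hh y hy (‖v‖⁻¹ • v) (by rw [norm_smul, norm_inv, norm_norm, inv_mul_cancel₀ hσ.ne'])
    (hcv.smul (inv_pos.2 hσ)) (hfv.smul (inv_pos.2 hσ)) f hf a ha b hb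
  set σ := ‖v‖ with hσdef
  have hbil : bilForm (M.g y) (σ⁻¹ • v) (σ⁻¹ • v) = bilForm (M.g y) v v / σ ^ 2 := by
    rw [bilForm_smul_left, bilForm_smul_right]
    field_simp
  rw [hbil] at h1 h2
  set u' := σ⁻¹ • v - h • ((-K * f + a * -(bilForm (M.g y) v v / σ ^ 2) - b) • W y +
    f • fderiv ℝ W y (σ⁻¹ • v)) with hu'
  have huv : v' = σ • u' := by
    have hφσ : φ = σ * (-K * f + a * -(bilForm (M.g y) v v / σ ^ 2) - b) := by
      rw [hφ]
      field_simp
    rw [hv', hu', hφσ, map_smul, smul_sub, smul_smul, mul_inv_cancel₀ hσ.ne', one_smul,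
      smul_comm σ h, smul_add σ, smul_smul σ, smul_comm σ f, smul_smul σ, mul_inv_cancel₀ hσ.ne',
      one_smul]
  rw [huv]
  refine ⟨h1.smul hσ, ?_⟩
  rw [bilForm_smul_left, bilForm_smul_right]
  have h3 := mul_le_mul_of_nonneg_left h2 (sq_nonneg σ)
  have h4 : σ ^ 2 * (-(bilForm (M.g y) v v / σ ^ 2) * (1 - h * C) + h * c * b) =
      (-bilForm (M.g y) v v) * (1 - h * C) + h * c * b * σ ^ 2 := by
    field_simp
  rw [h4] at h3
  linarith

/-- Pushing a causal curve against a time field. -/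
theorem exists_push_path {W : SpacetimePt n → SpacetimePt n} (hW : ContDiff ℝ 1 W)
    (hWn : ∀ y v, M.CausalVec y v → M.FdVec y v → bilForm (M.g y) v (W y) < 0) (R : ℝ) :
    ∃ K > 0, ∃ c > 0, ∀ F ≥ 0, ∀ A ≥ 0, ∃ C ≥ 0, ∀ᶠ h in 𝓝[>] (0 : ℝ),
      ∀ γ r s, r < s → M.IsLipPath γ r s →
        (∀ t ∈ Icc r s, γ t ∈ Metric.closedBall (0 : SpacetimePt n) R) →
      ∀ f : ℝ → ℝ, LocallyLipschitz f → (∀ t ∈ Icc r s, f t ∈ Icc 0 F) →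
      ∀ a ∈ Icc 0 A, ∀ b ∈ Icc (0 : ℝ) 1,
        (∀ᵐ t, t ∈ Ioo r s → HasDerivAt f (-K * ‖deriv γ t‖ * f t +
          a * (-bilForm (M.g (γ t)) (deriv γ t) (deriv γ t) / ‖deriv γ t‖) - b * ‖deriv γ t‖) t) →
        ∃ γ', M.IsLipPath γ' r s ∧ γ' r = γ r - (h * f r) • W (γ r) ∧
          γ' s = γ s - (h * f s) • W (γ s) ∧ √(1 - h * C) * M.gLength γ r s ≤ M.gLength γ' r s ∧
          √(h * c * b) * arcLen γ r s ≤ M.gLength γ' r s := by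
  obtain ⟨K, hK, c, hc, H⟩ := M.exists_push hW hWn R
  refine ⟨K, hK, c, hc, fun F hF A hA => ?_⟩
  obtain ⟨C, hC, hev⟩ := H F hF A hA
  refine ⟨C, hC, ?_⟩
  filter_upwards [hev, self_mem_nhdsWithin, eventually_mul_lt_of_pos C one_pos] with h hh hh0 hhC
    γ r s hrs hγ hball f hflip hf a ha b hb hode
  have hh0 : 0 < h := hh0
  set β : ℝ → SpacetimePt n := fun t => γ t - (h * f t) • W (γ t) with hβ
  have hβlip : LocallyLipschitz β := by
    obtain ⟨L, hL⟩ := hγ.1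
    have h1 : ContDiff ℝ 1 fun z : SpacetimePt n × ℝ => z.1 - (h * z.2) • W z.1 := by fun_prop
    exact h1.locallyLipschitz.comp (hL.locallyLipschitz.prodMk hflip)
  have hpt : ∀ᵐ t, t ∈ Ioo r s → DifferentiableAt ℝ β t ∧ M.CausalVec (β t) (deriv β t) ∧
      M.FdVec (β t) (deriv β t) ∧
      √(1 - h * C) * √(-bilForm (M.g (γ t)) (deriv γ t) (deriv γ t)) ≤
        √(-bilForm (M.g (β t)) (deriv β t) (deriv β t)) ∧
      √(h * c * b) * ‖deriv γ t‖ ≤ √(-bilForm (M.g (β t)) (deriv β t) (deriv β t)) := by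
    filter_upwards [hγ.2, hode] with t ht1 ht2 ht
    obtain ⟨hd, hcv, hfv⟩ := ht1 ht
    have hfd := ht2 ht
    have htI : t ∈ Icc r s := ⟨ht.1.le, ht.2.le⟩
    set φ := -K * ‖deriv γ t‖ * f t +
          a * (-bilForm (M.g (γ t)) (deriv γ t) (deriv γ t) / ‖deriv γ t‖) - b * ‖deriv γ t‖ with hφ
    have hWd : HasDerivAt (fun t => W (γ t)) (fderiv ℝ W (γ t) (deriv γ t)) t :=
      ((hW.differentiable one_ne_zero) (γ t)).hasFDerivAt.comp_hasDerivAt t hd.hasDerivAt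
    have hβd : HasDerivAt β
        (deriv γ t - h • (φ • W (γ t) + f t • fderiv ℝ W (γ t) (deriv γ t))) t := by
      have := hd.hasDerivAt.sub ((hfd.const_mul h).smul hWd)
      refine this.congr_deriv ?_
      module
    obtain ⟨h1, h2⟩ := hh (γ t) (hball t htI) (deriv γ t) hcv hfv (f t) (hf t htI) a ha b hb φ _ hφ rfl
    rw [← hβd.deriv] at h1 h2
    have hq0 : 0 ≤ -bilForm (M.g (γ t)) (deriv γ t) (deriv γ t) := neg_nonneg.2 hcv.2
    have h3 : 0 ≤ (-bilForm (M.g (γ t)) (deriv γ t) (deriv γ t)) * (1 - h * C) :=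
      mul_nonneg hq0 (by linarith)
    have h4 : 0 ≤ h * c * b := mul_nonneg (mul_pos hh0 hc).le hb.1
    have h5 : 0 ≤ h * c * b * ‖deriv γ t‖ ^ 2 := mul_nonneg h4 (sq_nonneg _)
    refine ⟨hβd.differentiableAt, ⟨fun h0 => ?_, ?_⟩, h1, ?_, ?_⟩
    · have : bilForm (M.g (β t)) (deriv β t) (M.X0 (β t)) < 0 := h1
      rw [h0] at this
      simp [bilForm] at this
    · exact neg_nonneg.1 ((add_nonneg h3 h5).trans h2)
    · rw [← Real.sqrt_mul (by linarith)]
      exact Real.sqrt_le_sqrt (by linarith)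
    · rw [← Real.sqrt_sq (norm_nonneg (deriv γ t)), ← Real.sqrt_mul h4]
      exact Real.sqrt_le_sqrt (by linarith)
  have hβpath : M.IsFdCausalPathOn β (Icc r s) := by
    refine ⟨ordConnected_Icc, nonempty_Icc.2 hrs.le, fun t _ => ?_, ?_⟩
    · obtain ⟨L, U, hU, hL⟩ := hβlip t
      exact ⟨L, U, mem_nhdsWithin_of_mem_nhds hU, hL⟩
    · rw [← restrict_Ioo_eq_restrict_Icc]
      exact (ae_restrict_iff' measurableSet_Ioo).2
        (hpt.mono fun t h ht => ⟨(h ht).1, (h ht).2.1, (h ht).2.2.1⟩)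
  obtain ⟨γ', hγ', heq, hlen⟩ := hβpath.exists_isLipPath hrs
  have heq' : EqOn β γ' (Ioo r s) := heq.mono Ioo_subset_Icc_self
  refine ⟨γ', hγ', (heq ⟨le_rfl, hrs.le⟩).symm, (heq ⟨hrs.le, le_rfl⟩).symm, ?_, ?_⟩
  · unfold gLength
    rw [← intervalIntegral.integral_const_mul]
    refine intervalIntegral_mono_ae_Ioo hrs.le ((hγ.intervalIntegrable_length _ _).const_mul _)
      (hγ'.intervalIntegrable_length _ _) (hpt.mono fun t h ht => ?_)
    rw [← (deriv_eq_of_eqOn_Ioo heq' ht).deriv_eq, ← heq' ht]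
    exact (h ht).2.2.2.1
  · unfold gLength arcLen
    rw [← intervalIntegral.integral_const_mul]
    refine intervalIntegral_mono_ae_Ioo hrs.le ((hγ.intervalIntegrable_norm_deriv _ _).const_mul _)
      (hγ'.intervalIntegrable_length _ _) (hpt.mono fun t h ht => ?_)
    rw [← (deriv_eq_of_eqOn_Ioo heq' ht).deriv_eq, ← heq' ht]
    exact (h ht).2.2.2.2

end C1Spacetime

namespace C1Spacetime

section Weights

variable {k : ℝ → ℝ} {B : ℝ}

theorem lipschitzWith_primitive (hk : Measurable k) (hB : ∀ t, |k t| ≤ B) (a : ℝ) :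
    LipschitzWith (Real.toNNReal B) fun t => ∫ x in a..t, k x := by
  have hB0 : 0 ≤ B := (abs_nonneg _).trans (hB 0)
  have hint : ∀ c d, IntervalIntegrable k volume c d := fun c d =>
    intervalIntegrable_of_measurable_bounded hk fun t _ => hB t
  refine LipschitzWith.of_dist_le_mul fun s t => ?_
  rw [Real.dist_eq, intervalIntegral.integral_interval_sub_left (hint _ _) (hint _ _),
    Real.coe_toNNReal _ hB0, Real.dist_eq]
  exact intervalIntegral.norm_integral_le_of_norm_le_const (f := k) (C := B) fun x _ => hB x

theorem ae_hasDerivAt_primitive (hk : Measurable k) (hB : ∀ t, |k t| ≤ B) (a : ℝ) :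
    ∀ᵐ t, HasDerivAt (fun t => ∫ x in a..t, k x) (k t) t := by
  have hloc : LocallyIntegrable k volume :=
    (locallyIntegrable_const B).mono hk.aestronglyMeasurable
      (.of_forall fun t => (hB t).trans (le_abs_self B))
  exact (_root_.LocallyIntegrable.ae_hasDerivAt_integral hloc).mono fun t h => h a

theorem primitive_mono (hk : Measurable k) (hB : ∀ t, |k t| ≤ B) (h0 : ∀ t, 0 ≤ k t) (a : ℝ) :
    Monotone fun t => ∫ x in a..t, k x := fun s t hst => by
  have hint : ∀ c d, IntervalIntegrable k volume c d := fun c d =>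
    intervalIntegrable_of_measurable_bounded hk fun t _ => hB t
  have h1 := intervalIntegral.integral_interval_sub_left (hint a t) (hint a s)
  have h2 : 0 ≤ ∫ x in s..t, k x := intervalIntegral.integral_nonneg hst fun x _ => h0 x
  simp only
  linarith

/-- The solution of `f' = -σ (K f + 1)` with `f s = 0`. -/
theorem exists_decaying_weight {σ : ℝ → ℝ} (hσ : Measurable σ) (hB : ∀ t, |σ t| ≤ B)
    (hσ0 : ∀ t, 0 ≤ σ t) {K : ℝ} (hK : 0 < K) (r s : ℝ) :
    ∃ f : ℝ → ℝ, LocallyLipschitz f ∧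
      (∀ t ∈ Icc r s, f t ∈ Icc 0 ((Real.exp (K * ∫ x in r..s, σ x) - 1) / K)) ∧
      f r = (Real.exp (K * ∫ x in r..s, σ x) - 1) / K ∧ f s = 0 ∧
      ∀ᵐ t, HasDerivAt f (-K * σ t * f t - σ t) t := by
  set S : ℝ → ℝ := fun t => ∫ x in r..t, σ x with hS
  have hSl := lipschitzWith_primitive hσ hB r
  have hSm := primitive_mono hσ hB hσ0 r
  have hSr : S r = 0 := intervalIntegral.integral_same
  refine ⟨fun t => (Real.exp (K * (S s - S t)) - 1) / K, ?_, fun t ht => ⟨?_, ?_⟩, ?_, ?_, ?_⟩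
  · have h1 : ContDiff ℝ 1 fun x : ℝ => (Real.exp (K * (S s - x)) - 1) / K := by fun_prop
    exact h1.locallyLipschitz.comp hSl.locallyLipschitz
  · have h1 : 0 ≤ K * (S s - S t) := mul_nonneg hK.le (sub_nonneg.2 (hSm ht.2))
    have h2 := Real.one_le_exp h1
    exact div_nonneg (by linarith) hK.le
  · have h1 : S r ≤ S t := hSm ht.1
    have h2 : S s - S t ≤ S s := by linarith
    change (Real.exp (K * (S s - S t)) - 1) / K ≤ (Real.exp (K * S s) - 1) / K
    gcongr
  · simp only [hSr, sub_zero]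
    rfl
  · simp
  · filter_upwards [ae_hasDerivAt_primitive hσ hB r] with t ht
    have h1 : HasDerivAt (fun t => (Real.exp (K * (S s - S t)) - 1) / K)
        (Real.exp (K * (S s - S t)) * (K * (0 - σ t)) / K) t :=
      (((((hasDerivAt_const t (S s)).sub ht).const_mul K).exp).sub_const 1).div_const K
    refine h1.congr_deriv ?_
    field_simp
    ring

theorem locallyLipschitz_exp_mul {S H : ℝ → ℝ} (hS : LocallyLipschitz S)
    (hH : LocallyLipschitz H) (K a : ℝ) :
    LocallyLipschitz fun t => a * (Real.exp (-(K * S t)) * H t) := by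
  have h1 : ContDiff ℝ 1 fun z : ℝ × ℝ => a * (Real.exp (-(K * z.1)) * z.2) := by fun_prop
  exact h1.locallyLipschitz.comp (hS.prodMk hH)

/-- A solution of `f' = -K σ f + a m` with `f r = 0` and `f s = κ`. -/
theorem exists_growing_weight {σ m : ℝ → ℝ} (hσ : Measurable σ) (hB : ∀ t, |σ t| ≤ B)
    (hσ0 : ∀ t, 0 ≤ σ t) (hm : Measurable m) {r s D : ℝ} (hrs : r < s)
    (hD : ∀ t ∈ Ioc r s, m t ≤ D) (hm0 : ∀ t ∈ Ioc r s, 0 ≤ m t) (hmpos : 0 < ∫ t in r..s, m t)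
    {K : ℝ} (hK : 0 < K) {κ : ℝ} (hκ : 0 ≤ κ) :
    ∃ (f : ℝ → ℝ) (a : ℝ), a ∈ Icc 0 (κ * Real.exp (K * ∫ t in r..s, σ t) / ∫ t in r..s, m t) ∧
      LocallyLipschitz f ∧
      (∀ t ∈ Icc r s, f t ∈ Icc 0 (κ * Real.exp (K * ∫ t in r..s, σ t))) ∧
      f r = 0 ∧ f s = κ ∧
      ∀ᵐ t, t ∈ Ioo r s → HasDerivAt f (-K * σ t * f t + a * m t) t := by
  set S : ℝ → ℝ := fun t => ∫ x in r..t, σ x with hS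
  have hSl := lipschitzWith_primitive hσ hB r
  have hSm := primitive_mono hσ hB hσ0 r
  have hSr : S r = 0 := intervalIntegral.integral_same
  set j : ℝ → ℝ := (Ioc r s).indicator fun t => Real.exp (K * S t) * m t with hj
  have hjm : Measurable j :=
    ((Real.measurable_exp.comp (hSl.continuous.measurable.const_mul K)).mul hm).indicator
      measurableSet_Ioc
  have hS0 : ∀ t, r ≤ t → 0 ≤ S t := fun t ht => hSr ▸ hSm ht
  have hj0 : ∀ t, 0 ≤ j t := fun t => indicator_nonneg
    (fun t ht => mul_nonneg (Real.exp_pos _).le (hm0 t ht)) t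
  have hD0 : 0 ≤ D := (hm0 s ⟨hrs, le_rfl⟩).trans (hD s ⟨hrs, le_rfl⟩)
  have hjB : ∀ t, |j t| ≤ Real.exp (K * S s) * D := fun t => by
    rw [abs_of_nonneg (hj0 t)]
    by_cases ht : t ∈ Ioc r s
    · rw [hj, indicator_of_mem ht]
      have h1 : S t ≤ S s := hSm ht.2
      have h2 := hD t ht
      have h3 := hm0 t ht
      gcongr
    · rw [hj, indicator_of_notMem ht]
      positivity
  set H : ℝ → ℝ := fun t => ∫ x in r..t, j x with hH
  have hHl := lipschitzWith_primitive hjm hjB r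
  have hHm := primitive_mono hjm hjB hj0 r
  have hHr : H r = 0 := intervalIntegral.integral_same
  have hmint : IntervalIntegrable m volume r s := by
    refine (intervalIntegrable_const (c := D)).mono_fun' hm.aestronglyMeasurable ?_
    filter_upwards [ae_restrict_mem measurableSet_uIoc] with t ht
    rw [uIoc_of_le hrs.le] at ht
    rw [Real.norm_of_nonneg (hm0 t ht)]
    exact hD t ht
  have hHs : ∫ t in r..s, m t ≤ H s := by
    refine intervalIntegral_mono_ae_Ioo hrs.le hmint
      (intervalIntegrable_of_measurable_bounded hjm fun t _ => hjB t) (.of_forall fun t ht => ?_)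
    have ht' : t ∈ Ioc r s := ⟨ht.1, ht.2.le⟩
    rw [hj, indicator_of_mem ht']
    exact le_mul_of_one_le_left (hm0 t ht') (Real.one_le_exp (mul_nonneg hK.le (hS0 t ht.1.le)))
  have hHs0 : 0 < H s := hmpos.trans_le hHs
  set a := κ * Real.exp (K * S s) / H s with ha
  have ha0 : 0 ≤ a := by positivity
  have haH : a * H s = κ * Real.exp (K * S s) := div_mul_cancel₀ _ hHs0.ne'
  refine ⟨fun t => a * (Real.exp (-(K * S t)) * H t), a, ⟨ha0, ?_⟩, ?_, fun t ht => ⟨?_, ?_⟩, ?_, ?_,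
    ?_⟩
  · change κ * Real.exp (K * S s) / H s ≤ κ * Real.exp (K * S s) / ∫ t in r..s, m t
    gcongr
  · exact locallyLipschitz_exp_mul hSl.locallyLipschitz hHl.locallyLipschitz K a
  · have : 0 ≤ H t := hHr ▸ hHm ht.1
    positivity
  · change a * (Real.exp (-(K * S t)) * H t) ≤ κ * Real.exp (K * S s)
    rw [← haH]
    have h1 : H t ≤ H s := hHm ht.2
    have h2 : 0 ≤ H t := hHr ▸ hHm ht.1
    have h3 : Real.exp (-(K * S t)) ≤ 1 :=
      Real.exp_le_one_iff.2 (neg_nonpos.2 (mul_nonneg hK.le (hS0 t ht.1)))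
    have h4 := mul_le_of_le_one_left h2 h3
    gcongr
    linarith
  · simp [hHr]
  · calc a * (Real.exp (-(K * S s)) * H s) = a * H s * Real.exp (-(K * S s)) := by ring
      _ = κ * (Real.exp (K * S s) * Real.exp (-(K * S s))) := by rw [haH]; ring
      _ = κ := by rw [← Real.exp_add, add_neg_cancel, Real.exp_zero, mul_one]
  · filter_upwards [ae_hasDerivAt_primitive hσ hB r, ae_hasDerivAt_primitive hjm hjB r]
      with t ht ht' htm
    have h1 : HasDerivAt (fun t => a * (Real.exp (-(K * S t)) * H t))
        (a * (Real.exp (-(K * S t)) * (-(K * σ t)) * H t + Real.exp (-(K * S t)) * j t)) t :=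
      (((ht.const_mul K).neg.exp).mul ht').const_mul a
    refine h1.congr_deriv ?_
    have h2 : Real.exp (-(K * S t)) * j t = m t := by
      rw [hj, indicator_of_mem (show t ∈ Ioc r s from ⟨htm.1, htm.2.le⟩), ← mul_assoc,
        ← Real.exp_add, neg_add_cancel, Real.exp_zero, one_mul]
    rw [h2]
    ring

end Weights

end C1Spacetime

namespace C1Spacetime

variable {n : ℕ} {M : C1Spacetime n}

theorem intervalIntegral_pos_of_ae_pos {f : ℝ → ℝ} {a b : ℝ} (hab : a < b)
    (hf : IntervalIntegrable f volume a b) (h : ∀ᵐ t, t ∈ Ioo a b → 0 < f t) :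
    0 < ∫ t in a..b, f t := by
  have hIoc : ∀ᵐ t, t ∈ Ioc a b → 0 < f t := by
    have hb : ∀ᵐ t : ℝ, t ≠ b := by simp [ae_iff, measure_singleton]
    filter_upwards [h, hb] with t h1 h2 h3
    exact h1 ⟨h3.1, lt_of_le_of_ne h3.2 h2⟩
  rw [intervalIntegral.integral_pos_iff_support_of_nonneg_ae' _ hf]
  · refine ⟨hab, ?_⟩
    have : (Function.support f ∩ Ioc a b : Set ℝ) =ᵐ[volume] Ioc a b := by
      filter_upwards [hIoc] with t ht
      exact propext ⟨fun h => h.2, fun h => ⟨(ht h).ne', h⟩⟩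
    rw [measure_congr this]
    simpa using hab
  · rw [uIoc_of_le hab.le]
    exact (ae_restrict_iff' measurableSet_Ioc).2 (hIoc.mono fun t h1 h2 => (h1 h2).le)

theorem IsLipPath.arcLen_pos {γ : ℝ → SpacetimePt n} {a b : ℝ} (h : M.IsLipPath γ a b)
    (hab : a < b) : 0 < arcLen γ a b :=
  intervalIntegral_pos_of_ae_pos hab (h.intervalIntegrable_norm_deriv _ _)
    (h.2.mono fun _ h1 h2 => norm_pos_iff.2 (h1 h2).2.1.1)

theorem IsLipPath.gLength_le_mul_arcLen {γ : ℝ → SpacetimePt n} {a b G : ℝ}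
    (h : M.IsLipPath γ a b) (hab : a ≤ b) (hG0 : 0 ≤ G)
    (hG : ∀ t ∈ Icc a b, ∀ u v, |bilForm (M.g (γ t)) u v| ≤ G * ‖u‖ * ‖v‖) :
    M.gLength γ a b ≤ √G * arcLen γ a b := by
  unfold gLength arcLen
  rw [← intervalIntegral.integral_const_mul]
  refine intervalIntegral.integral_mono_on hab (h.intervalIntegrable_length _ _)
    ((h.intervalIntegrable_norm_deriv _ _).const_mul _) fun t ht => ?_
  rw [← Real.sqrt_sq (norm_nonneg (deriv γ t)), ← Real.sqrt_mul hG0]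
  refine Real.sqrt_le_sqrt ?_
  linarith [(abs_le.1 (hG t ht (deriv γ t) (deriv γ t))).1]

theorem exists_gLength_gt {p y : SpacetimePt n} {N : ℝ} (h : ENNReal.ofReal N < M.ldist p y) :
    ∃ γ a b, a < b ∧ M.IsLipPath γ a b ∧ γ a = p ∧ γ b = y ∧ N < M.gLength γ a b := by
  by_contra! hcon
  exact absurd (ldist_le fun γ a b hab hγ ha hb =>
    ENNReal.ofReal_le_ofReal (hcon γ a b hab hγ ha hb)) (not_le.2 h)

theorem eta_sqrt_le {q σ η : ℝ} (hσ : 0 < σ) (hη : 0 ≤ η) (hq : 0 ≤ q) :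
    η * √q - η ^ 2 * σ ≤ q / σ := by
  rw [le_div_iff₀ hσ]
  have h1 := Real.sq_sqrt hq
  have h2 := mul_nonneg hη (Real.sqrt_nonneg q)
  nlinarith [sq_nonneg (√q - η * σ), mul_nonneg h2 hσ.le]

/-- The weight along a causal curve of positive length which starts at zero. -/
theorem IsLipPath.exists_growing_weight {γ : ℝ → SpacetimePt n} {r s G η ℓ A K κ : ℝ}
    (h : M.IsLipPath γ r s) (hrs : r < s)
    (hG : ∀ t ∈ Icc r s, ∀ u v, |bilForm (M.g (γ t)) u v| ≤ G * ‖u‖ * ‖v‖) (hG0 : 0 ≤ G)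
    (hη : 0 ≤ η) (hℓ : 0 < ℓ) (hlen : ℓ ≤ η * M.gLength γ r s - η ^ 2 * A)
    (hA : arcLen γ r s ≤ A) (hK : 0 < K) (hκ : 0 ≤ κ) :
    ∃ (f : ℝ → ℝ) (a : ℝ), a ∈ Icc 0 (κ * Real.exp (K * A) / ℓ) ∧ LocallyLipschitz f ∧
      (∀ t ∈ Icc r s, f t ∈ Icc 0 (κ * Real.exp (K * A))) ∧ f r = 0 ∧ f s = κ ∧
      ∀ᵐ t, t ∈ Ioo r s → HasDerivAt f (-K * ‖deriv γ t‖ * f t +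
        a * (-bilForm (M.g (γ t)) (deriv γ t) (deriv γ t) / ‖deriv γ t‖)) t := by
  obtain ⟨L, hL⟩ := h.1
  have hLd : ∀ t, ‖deriv γ t‖ ≤ L := fun t => norm_deriv_le_of_lipschitz hL
  set m : ℝ → ℝ := fun t =>
    max 0 (-bilForm (M.g (γ t)) (deriv γ t) (deriv γ t) / ‖deriv γ t‖) with hm
  have hmm : Measurable m := measurable_const.max
    ((measurable_bilForm_deriv h.continuous).neg.div (measurable_deriv γ).norm)
  have hm0 : ∀ t, 0 ≤ m t := fun t => le_max_left _ _
  have hmD : ∀ t ∈ Icc r s, m t ≤ G * L := fun t ht => by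
    refine max_le (by positivity) ?_
    rcases (norm_nonneg (deriv γ t)).eq_or_lt with h0 | h0
    · rw [← h0, div_zero]
      positivity
    · rw [div_le_iff₀ h0]
      have h1 := (abs_le.1 (hG t ht (deriv γ t) (deriv γ t))).1
      have h2 : G * ‖deriv γ t‖ * ‖deriv γ t‖ ≤ G * L * ‖deriv γ t‖ := by
        have := hLd t
        gcongr
      linarith
  have hmae : ∀ᵐ t, t ∈ Ioo r s →
      m t = -bilForm (M.g (γ t)) (deriv γ t) (deriv γ t) / ‖deriv γ t‖ :=
    h.2.mono fun t h1 h2 => max_eq_right (div_nonneg (neg_nonneg.2 (h1 h2).2.1.2) (norm_nonneg _))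
  have hmint : IntervalIntegrable m volume r s :=
    intervalIntegrable_of_measurable_bounded hmm fun t ht => by
      rw [abs_of_nonneg (hm0 t)]
      exact hmD t (uIcc_of_le hrs.le ▸ ht)
  have hmlow : ℓ ≤ ∫ t in r..s, m t := by
    have h1 : η * M.gLength γ r s - η ^ 2 * arcLen γ r s ≤ ∫ t in r..s, m t := by
      have hi1 := (h.intervalIntegrable_length r s).const_mul η
      have hi2 := (h.intervalIntegrable_norm_deriv r s).const_mul (η ^ 2)
      unfold gLength arcLen
      rw [← intervalIntegral.integral_const_mul, ← intervalIntegral.integral_const_mul,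
        ← intervalIntegral.integral_sub hi1 hi2]
      refine intervalIntegral_mono_ae_Ioo hrs.le (hi1.sub hi2) hmint ?_
      filter_upwards [h.2, hmae] with t h1 h2 ht
      obtain ⟨-, hcv, -⟩ := h1 ht
      rw [h2 ht]
      exact eta_sqrt_le (norm_pos_iff.2 hcv.1) hη (neg_nonneg.2 hcv.2)
    have h2 : η ^ 2 * arcLen γ r s ≤ η ^ 2 * A := by gcongr
    linarith
  have hmpos : 0 < ∫ t in r..s, m t := hℓ.trans_le hmlow
  have hexp : κ * Real.exp (K * arcLen γ r s) ≤ κ * Real.exp (K * A) := by gcongr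
  obtain ⟨f, a, ha, hfl, hf, hfr, hfs, hd⟩ := C1Spacetime.exists_growing_weight
    (σ := fun t => ‖deriv γ t‖) (measurable_deriv γ).norm (B := L)
    (fun t => by rw [abs_norm]; exact hLd t) (fun t => norm_nonneg _) hmm hrs
    (fun t ht => hmD t ⟨ht.1.le, ht.2⟩) (fun t _ => hm0 t) hmpos hK hκ
  refine ⟨f, a, ⟨ha.1, ha.2.trans ?_⟩, hfl, fun t ht => ⟨(hf t ht).1, (hf t ht).2.trans hexp⟩,
    hfr, hfs, ?_⟩
  · change κ * Real.exp (K * arcLen γ r s) / _ ≤ _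
    gcongr
  · filter_upwards [hd, hmae] with t h1 h2 ht
    rw [← h2 ht]
    exact h1 ht

/-- Prolonging by a causal curve strictly increases a positive Lorentzian distance. -/
theorem GloballyHyperbolic.ldist_lt_of_isLipPath (hGH : M.GloballyHyperbolic)
    {p : SpacetimePt n} {x : ℝ → SpacetimePt n} {c d : ℝ} (hcd : c < d) (hx : M.IsLipPath x c d)
    (hpy : M.causalLe p (x c)) (hpos : 0 < M.ldist p (x c)) :
    M.ldist p (x c) < M.ldist p (x d) := by
  obtain ⟨A, hA, hAb⟩ := hGH.exists_arcLen_bound p (x c)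
  obtain ⟨R, hR⟩ := (hGH.2 p (x d)).isBounded.subset_closedBall 0
  have hxR : ∀ t ∈ Icc c d, x t ∈ Metric.closedBall (0 : SpacetimePt n) R := fun t ht =>
    hR ⟨hpy.trans ((hx.mono le_rfl ht.2).causalLe ht.1), (hx.mono ht.1 le_rfl).causalLe ht.2⟩
  have hγR : ∀ γ a b, M.IsLipPath γ a b → γ a = p → γ b = x c → ∀ t ∈ Icc a b,
      γ t ∈ Metric.closedBall (0 : SpacetimePt n) R := fun γ a b h ha hb t ht =>
    hR ⟨ha ▸ (h.mono le_rfl ht.2).causalLe ht.1,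
      (hb ▸ (h.mono ht.1 le_rfl).causalLe ht.2 : M.causalLe (γ t) (x c)).trans
        (hx.causalLe hcd.le)⟩
  obtain ⟨G, hG0, hG⟩ := M.exists_metric_bound R
  have hfin : M.ldist p (x c) ≠ ⊤ := by
    refine ne_top_of_le_ne_top (b := ENNReal.ofReal (√G * A)) ENNReal.ofReal_ne_top
      (ldist_le fun γ a b hab h ha hb => ENNReal.ofReal_le_ofReal ?_)
    refine (h.gLength_le_mul_arcLen hab.le hG0 fun t ht => hG _ (hγR γ a b h ha hb t ht)).trans ?_
    have := hAb γ a b hab h ha hb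
    gcongr
  set D := (M.ldist p (x c)).toReal with hD
  have hDT : ENNReal.ofReal D = M.ldist p (x c) := ENNReal.ofReal_toReal hfin
  have hD0 : 0 < D := ENNReal.toReal_pos hpos.ne' hfin
  obtain ⟨W, hW, hWn⟩ := M.exists_contDiff_timeField
  obtain ⟨K, hK, c₁, hc₁, hpush⟩ := M.exists_push_path hW hWn R
  have hAx := hx.arcLen_pos hcd
  set Ax := arcLen x c d with hAxd
  set κ := (Real.exp (K * Ax) - 1) / K with hκ
  have hκ0 : 0 ≤ κ := by
    have := Real.one_le_exp (mul_pos hK hAx).le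
    exact div_nonneg (by linarith) hK.le
  set η := D / (4 * A) with hη
  have hη0 : 0 < η := by positivity
  have hηA : η * A = D / 4 := by rw [hη]; field_simp
  set ℓ := η * (D / 4) with hℓ
  have hℓ0 : 0 < ℓ := by positivity
  obtain ⟨C, hC, hev⟩ := hpush (κ * Real.exp (K * A)) (by positivity)
    (κ * Real.exp (K * A) / ℓ) (by positivity)
  have hmem : ∀ᶠ h in 𝓝[>] (0 : ℝ), h ∈ Ioi (0 : ℝ) := self_mem_nhdsWithin
  obtain ⟨h, hpushh, hh0, hhC, hhA⟩ := (hev.and (hmem.and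
    ((eventually_mul_lt_of_pos C one_pos).and (eventually_mul_lt_of_pos ((C * D) ^ 2)
      (show 0 < c₁ * Ax ^ 2 by positivity))))).exists
  have hh0 : 0 < h := hh0
  have hκle : κ ≤ κ * Real.exp (K * A) :=
    le_mul_of_one_le_right hκ0 (Real.one_le_exp (mul_pos hK hA).le)
  -- the pushed prolongation
  obtain ⟨L, hL⟩ := hx.1
  obtain ⟨f, hfl, hf, hfc, hfd, hfode⟩ := exists_decaying_weight (σ := fun t => ‖deriv x t‖)
    (measurable_deriv x).norm (B := L)
    (fun t => by rw [abs_norm]; exact norm_deriv_le_of_lipschitz hL) (fun t => norm_nonneg _) hK c d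
  obtain ⟨x', hx', hx'c, hx'd, -, hx'len⟩ := hpushh x c d hcd hx hxR f hfl
    (fun t ht => ⟨(hf t ht).1, (hf t ht).2.trans hκle⟩) 0 ⟨le_rfl, by positivity⟩ 1
    ⟨zero_le_one, le_rfl⟩ (hfode.mono fun t ht _ => ht.congr_deriv (by ring))
  rw [mul_one] at hx'len
  rw [hfd, mul_zero, zero_smul, sub_zero] at hx'd
  -- the gain beats the loss
  have hgain : h * C * D < √(h * c₁) * Ax := by
    rw [← Real.sqrt_sq hAx.le, ← Real.sqrt_mul (by positivity)]
    refine Real.lt_sqrt_of_sq_lt ?_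
    nlinarith
  obtain ⟨γ, a, b, hab, hγ, ha, hb, hlen⟩ := exists_gLength_gt (M := M) (p := p) (y := x c)
    (N := max (D / 2) (D - (√(h * c₁) * Ax - h * C * D))) (by
      rw [← hDT]
      exact (ENNReal.ofReal_lt_ofReal_iff hD0).2 (max_lt (by linarith) (by linarith)))
  obtain ⟨hlen1, hlen2⟩ := max_lt_iff.1 hlen
  obtain ⟨f₁, a₁, ha₁, hf₁l, hf₁, hf₁a, hf₁b, hode₁⟩ := hγ.exists_growing_weight (ℓ := ℓ) hab
    (fun t ht => hG _ (hγR γ a b hγ ha hb t ht)) hG0 hη0.le hℓ0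
    (by
      have h1 : η * (D / 2) ≤ η * M.gLength γ a b := by gcongr
      have h2 : η ^ 2 * A = η * (D / 4) := by rw [pow_two, mul_assoc, hηA]
      linarith) (hAb γ a b hab hγ ha hb) hK hκ0
  obtain ⟨γ', hγ', hγ'a, hγ'b, hγ'len, -⟩ := hpushh γ a b hab hγ (hγR γ a b hγ ha hb) f₁ hf₁l hf₁
    a₁ ha₁ 0 ⟨le_rfl, zero_le_one⟩ (hode₁.mono fun t ht htm => (ht htm).congr_deriv (by ring))
  rw [hf₁a, mul_zero, zero_smul, sub_zero, ha] at hγ'a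
  rw [hf₁b, hb] at hγ'b
  obtain ⟨Γ, e, hbe, hΓ, hΓa, hΓe, hΓlen⟩ := hγ'.exists_trans hab hcd hx' (by
    rw [hγ'b, hx'c, hfc]
    rfl)
  have hfinal := hΓ.gLength_le_ldist (hab.trans hbe)
  rw [hΓa, hΓe, hγ'a, hx'd, hΓlen] at hfinal
  refine lt_of_lt_of_le ?_ hfinal
  rw [← hDT]
  refine (ENNReal.ofReal_lt_ofReal_iff_of_nonneg hD0.le).2 ?_
  have hsq : 1 - h * C ≤ √(1 - h * C) := by
    refine Real.le_sqrt_of_sq_le ?_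
    nlinarith [mul_nonneg hh0.le hC]
  have hLpos : 0 < M.gLength γ a b := by linarith
  have h1 : (1 - h * C) * M.gLength γ a b ≤ √(1 - h * C) * M.gLength γ a b := by gcongr
  have h2 : (1 - h * C) * (D - (√(h * c₁) * Ax - h * C * D)) < (1 - h * C) * M.gLength γ a b :=
    mul_lt_mul_of_pos_left hlen2 (by linarith)
  have h3 : 0 ≤ h * C * (√(h * c₁) * Ax - h * C * D) :=
    mul_nonneg (mul_nonneg hh0.le hC) (by linarith)
  linarith

theorem IsFdTimelikePathOn.isFdCausalPathOn {γ : ℝ → SpacetimePt n} {I : Set ℝ}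
    (h : M.IsFdTimelikePathOn γ I) : M.IsFdCausalPathOn γ I := by
  refine ⟨h.1, h.2.1, h.2.2.1, h.2.2.2.mono fun t ht => ⟨ht.1, ⟨fun h0 => ?_, ht.2.1.le⟩, ht.2.2⟩⟩
  have := ht.2.1
  simp [TimelikeVec, h0, bilForm] at this

theorem chron.causalLe {p q : SpacetimePt n} (h : M.chron p q) : M.causalLe p q := by
  obtain ⟨γ, a, b, hab, hγ, ha, hb⟩ := h
  exact Or.inr ⟨γ, a, b, hab, hγ.isFdCausalPathOn, ha, hb⟩

theorem chron.ldist_pos {p q y : SpacetimePt n} (h : M.chron p q) (hqy : M.causalLe q y) :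
    0 < M.ldist p y := by
  obtain ⟨γ, a, b, hab, hγ, ha, hb⟩ := h
  obtain ⟨β, hβ, heq, hlen⟩ := hγ.isFdCausalPathOn.exists_isLipPath hab
  have hβpos : 0 < M.gLength β a b := by
    refine intervalIntegral_pos_of_ae_pos hab (hβ.intervalIntegrable_length _ _) ?_
    have h1 := hγ.2.2.2
    rw [← restrict_Ioo_eq_restrict_Icc, ae_restrict_iff' measurableSet_Ioo] at h1
    filter_upwards [h1] with t ht htm
    have heq' : EqOn γ β (Ioo a b) := heq.mono Ioo_subset_Icc_self
    rw [← (deriv_eq_of_eqOn_Ioo heq' htm).deriv_eq, ← heq' htm]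
    exact Real.sqrt_pos.2 (neg_pos.2 (ht htm).2.1)
  have hβa : β a = p := (heq ⟨le_rfl, hab.le⟩).symm.trans ha
  have hβb : β b = q := (heq ⟨hab.le, le_rfl⟩).symm.trans hb
  rcases causalLe_iff.1 hqy with rfl | ⟨α, c, d, hcd, hα, hαc, hαd⟩
  · have := hβ.gLength_le_ldist hab
    rw [hβa, hβb] at this
    exact (ENNReal.ofReal_pos.2 hβpos).trans_le this
  · obtain ⟨Γ, e, hbe, hΓ, hΓa, hΓe, hΓlen⟩ := hβ.exists_trans hab hcd hα (hβb.trans hαc.symm)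
    have := hΓ.gLength_le_ldist (hab.trans hbe)
    rw [hΓa, hΓe, hβa, hαd, hΓlen] at this
    exact (ENNReal.ofReal_pos.2 (add_pos_of_pos_of_nonneg hβpos (gLength_nonneg α hcd.le))).trans_le
      this

theorem IsFdCausalGeodesicOn.isFdCausalPathOn {x : ℝ → SpacetimePt n} {I : Set ℝ}
    (h : M.IsFdCausalGeodesicOn x I) (hI : I.OrdConnected) {s t : ℝ} (hs : s ∈ I) (ht : t ∈ I)
    (hst : s ≤ t) : M.IsFdCausalPathOn x (Icc s t) := by
  have hsub : Icc s t ⊆ I := hI.out hs ht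
  refine ⟨ordConnected_Icc, nonempty_Icc.2 hst, fun r hr => ?_, ?_⟩
  · obtain ⟨K, U, hU, hK⟩ := (((h.1.1.mono hsub).of_le one_le_two) r hr).exists_lipschitzOnWith
      (convex_Icc s t)
    exact ⟨K, U, hU, hK⟩
  · rw [← restrict_Ioo_eq_restrict_Icc]
    refine (ae_restrict_iff' measurableSet_Ioo).2 (.of_forall fun r hr => ?_)
    have hnhds : I ∈ 𝓝 r := mem_of_superset (Ioo_mem_nhds hr.1 hr.2)
      (Ioo_subset_Icc_self.trans hsub)
    have hrI : r ∈ I := mem_of_mem_nhds hnhds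
    have := h.2 r hrI
    rw [derivWithin_of_mem_nhds hnhds] at this
    exact ⟨((h.1.1 r hrI).contDiffAt hnhds).differentiableAt two_ne_zero, this⟩

end C1Spacetime

open C1Spacetime in
/-- Lemma 4.11: in a globally hyperbolic C¹-spacetime, the Lorentzian distance
`T(p, x(t))` is strictly increasing along a future-directed causal geodesic `x`
starting at `q` with `p ≪ q`. -/
theorem ldist_strictMono_along_causal_geodesic
    {n : ℕ} (hn : 2 ≤ n) (M : C1Spacetime n) (hGH : M.GloballyHyperbolic)
    (p q : SpacetimePt n) (hpq : M.chron p q)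
    (I : Set ℝ) (hI : I.OrdConnected) (h0I : (0:ℝ) ∈ I) (hmin : ∀ t ∈ I, (0:ℝ) ≤ t)
    (x : ℝ → SpacetimePt n) (hgeo : M.IsFdCausalGeodesicOn x I) (hx0 : x 0 = q) :
    ∀ s ∈ I, ∀ t ∈ I, s < t → M.ldist p (x s) < M.ldist p (x t) := by
  intro s hs t ht hst
  have hqs : M.causalLe q (x s) := by
    rcases (hmin s hs).eq_or_lt with h0 | h0
    · exact Or.inl (by rw [← hx0, h0])
    · exact Or.inr ⟨x, 0, s, h0, hgeo.isFdCausalPathOn hI h0I hs h0.le, hx0, rfl⟩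
  obtain ⟨x', hx', heq, -⟩ := (hgeo.isFdCausalPathOn hI hs ht hst.le).exists_isLipPath hst
  rw [heq ⟨le_rfl, hst.le⟩] at hqs ⊢
  rw [heq ⟨hst.le, le_rfl⟩]
  exact hGH.ldist_lt_of_isLipPath hst hx' (hpq.causalLe.trans hqs) (hpq.ldist_pos hqs)
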